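/- Let 𝔾 be a toroidal grid diagram of grid number n with 4-fold diagram 𝔾₄. Then (GC•(𝔾), ∂•) is a chain complex (i.e. ∂• ∘ ∂• = 0), and the 𝔽[V₁,…,V_n,v]-module isomorphism J₄ : GC•(𝔾) → GC•(𝔾₄) induced by the bijection x ↦ x₄ on grid states satisfies ∂₄• ∘ J₄ = J₄ ∘ ∂•; hence J₄ is an isomorphism of bigraded chain complexes. -/

import Mathlib

/-!
Combinatorial model of toroidal grid diagrams, their 4-fold covers, and the
double-point enhanced grid complex (over 𝔽 = ℤ/2ℤ), following Lipshitz and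
Ozsváth–Szabó–Sarkar conventions.

* The torus is modelled by `ZMod n × ZMod n`: the horizontal circle `α_j` and
  vertical circle `β_k` meet at the point `(k, j)`; the square `(k, j)` is the
  one with south-west corner at the point `(k, j)`;  the `O`- and `X`-markings
  of column `k` occupy squares `(k, Orow k)` and `(k, Xrow k)`.
* A grid state is a bijection (column ↦ row), i.e. a permutation of `ZMod n`.
* The 4-fold cover `𝔾₄` lives on `ZMod (2n) × ZMod (2n)`, with the covering
  map `pr` reducing coordinates mod `n`.  A grid state of `𝔾₄` is the preimage
  of a grid state of `𝔾`, so grid states of `𝔾₄` are canonically identified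
  with grid states of `𝔾`; similarly the free module `GC` underlying both
  `GC•(𝔾)` and `GC•(𝔾₄)` is the same, and the identification `J₄` is the
  identity map.
* Rectangles are recorded by their two vertical circles (west/east) and two
  horizontal circles (south/north); "rectangle from x₄ to y₄" is the boundary
  condition `∂(∂_α(r + Nr + Er + NEr)) = y₄ - x₄` (and the `∂_β` analogue),
  expressed via corner-point indicator functions.  Each `N,E`-equivalence class
  of rectangles in `𝔾₄` contains exactly one *normalized* representative
  (west circle and south circle in the first fundamental domain), so sums over
  equivalence classes are sums over normalized representatives.
-/

noncomputable section

open scoped Classical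

namespace GridHomology

/-- the ground field `𝔽 = ℤ/2ℤ` -/
abbrev F : Type := ZMod 2

/-- A toroidal grid diagram of grid number `n`. -/
structure GridDiagram (n : ℕ) where
  Orow : ZMod n → ZMod n
  Xrow : ZMod n → ZMod n
  hO : Function.Bijective Orow
  hX : Function.Bijective Xrow
  hOX : ∀ i, Orow i ≠ Xrow i

/-- A grid state: one point on each horizontal and each vertical circle. -/
abbrev GridState (n : ℕ) := Equiv.Perm (ZMod n)

instance twoMulNeZero (n : ℕ) [NeZero n] : NeZero (2 * n) :=
  ⟨fun h => NeZero.ne n (by omega)⟩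

/-- membership in the cyclic (going east/north) interval `[u, v)` -/
def inIco {m : ℕ} (u v k : ZMod m) : Prop := (k - u).val < (v - u).val

/-- membership in the open cyclic interval `(u, v)` -/
def inIoo {m : ℕ} (u v k : ZMod m) : Prop :=
  0 < (k - u).val ∧ (k - u).val < (v - u).val

instance {m : ℕ} (u v k : ZMod m) : Decidable (inIco u v k) :=
  inferInstanceAs (Decidable (_ < _))

instance {m : ℕ} (u v k : ZMod m) : Decidable (inIoo u v k) :=
  inferInstanceAs (Decidable (_ ∧ _))

/-- Rectangle data on the `m × m` torus: west and east vertical circles,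
south and north horizontal circles. -/
structure Rect (m : ℕ) where
  cW : ZMod m
  cE : ZMod m
  rS : ZMod m
  rN : ZMod m
deriving DecidableEq

instance (m : ℕ) [NeZero m] : Fintype (Rect m) :=
  Fintype.ofEquiv (ZMod m × ZMod m × ZMod m × ZMod m)
    { toFun := fun p => ⟨p.1, p.2.1, p.2.2.1, p.2.2.2⟩
      invFun := fun r => ⟨r.cW, r.cE, r.rS, r.rN⟩
      left_inv := fun _ => rfl
      right_inv := fun _ => rfl }

/-- local multiplicity of a rectangle at a square of the torus -/
def Rect.mult {m : ℕ} (r : Rect m) (sq : ZMod m × ZMod m) : ℕ :=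
  if inIco r.cW r.cE sq.1 ∧ inIco r.rS r.rN sq.2 then 1 else 0

/-- `r` is an (embedded, not necessarily empty) rectangle from `x` to `y` in `𝔾`:
its south-west and north-east corners lie in `x`, its south-east and north-west
corners lie in `y`, and `x`, `y` agree away from the two vertical circles of `r`. -/
def IsRectFrom {m : ℕ} (x y : GridState m) (r : Rect m) : Prop :=
  r.cW ≠ r.cE ∧ r.rS ≠ r.rN ∧
  x r.cW = r.rS ∧ x r.cE = r.rN ∧ y r.cW = r.rN ∧ y r.cE = r.rS ∧
  ∀ k, k ≠ r.cW → k ≠ r.cE → x k = y k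

/-- point-measure of a rectangle in `𝔾` at a grid state `w`: the sum over the
points of `w` of the average of the four adjacent local multiplicities -/
def Rect.pm {m : ℕ} [NeZero m] (w : GridState m) (r : Rect m) : ℚ :=
  (∑ k : ZMod m, ((r.mult (k - 1, w k - 1) + r.mult (k, w k - 1) +
      r.mult (k - 1, w k) + r.mult (k, w k) : ℕ) : ℚ)) / 4

/-- `m(r) = #(Int r ∩ x)` -/
def Rect.intCount {m : ℕ} [NeZero m] (x : GridState m) (r : Rect m) : ℕ :=
  (Finset.univ.filter fun k => inIoo r.cW r.cE k ∧ inIoo r.rS r.rN (x k)).card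

/-- `O_i(r)` in `𝔾` -/
def Ocount {m : ℕ} (G : GridDiagram m) (r : Rect m) (i : ZMod m) : ℕ :=
  r.mult (i, G.Orow i)

/-- `X_i(r)` in `𝔾` -/
def Xcount {m : ℕ} (G : GridDiagram m) (r : Rect m) (i : ZMod m) : ℕ :=
  r.mult (i, G.Xrow i)

/-- `r ∩ 𝕏 = ∅` -/
def XDisjoint {m : ℕ} (G : GridDiagram m) (r : Rect m) : Prop :=
  ∀ i, Xcount G r i = 0

/-! ### The 4-fold cover -/

/-- the covering projection `π₄ : 𝔾₄ → 𝔾` on coordinates -/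
def pr {n : ℕ} (a : ZMod (2 * n)) : ZMod n :=
  ZMod.castHom (dvd_mul_left n 2) (ZMod n) a

/-- indicator function (as a formal sum of points) of the lifted grid state `x₄` -/
def stInd {n : ℕ} (x : GridState n) (p : ZMod (2 * n) × ZMod (2 * n)) : ℤ :=
  if x (pr p.1) = pr p.2 then 1 else 0

/-- `∂(∂_α r)` as a formal sum of points: `SE + NW − SW − NE` -/
def cornerA {m : ℕ} (r : Rect m) (p : ZMod m × ZMod m) : ℤ :=
  (if p = (r.cE, r.rS) then 1 else 0) + (if p = (r.cW, r.rN) then 1 else 0)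
    - (if p = (r.cW, r.rS) then 1 else 0) - (if p = (r.cE, r.rN) then 1 else 0)

/-- `∂(∂_β r)` as a formal sum of points: `NE + SW − SE − NW` -/
def cornerB {m : ℕ} (r : Rect m) (p : ZMod m × ZMod m) : ℤ :=
  (if p = (r.cE, r.rN) then 1 else 0) + (if p = (r.cW, r.rS) then 1 else 0)
    - (if p = (r.cE, r.rS) then 1 else 0) - (if p = (r.cW, r.rN) then 1 else 0)

/-- northward translation `N` by `n` rows -/
def trN {n : ℕ} (r : Rect (2 * n)) : Rect (2 * n) :=
  ⟨r.cW, r.cE, r.rS + (n : ZMod (2 * n)), r.rN + (n : ZMod (2 * n))⟩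

/-- eastward translation `E` by `n` columns -/
def trE {n : ℕ} (r : Rect (2 * n)) : Rect (2 * n) :=
  ⟨r.cW + (n : ZMod (2 * n)), r.cE + (n : ZMod (2 * n)), r.rS, r.rN⟩

/-- `r` is a rectangle from `x₄` to `y₄` in the 4-fold diagram `𝔾₄`:
`∂(∂_α (r + Nr + Er + NEr)) = y₄ − x₄` and `∂(∂_β (r + Nr + Er + NEr)) = x₄ − y₄`. -/
def IsRect4From {n : ℕ} (x y : GridState n) (r : Rect (2 * n)) : Prop :=
  r.cW ≠ r.cE ∧ r.rS ≠ r.rN ∧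
  (∀ p, cornerA r p + cornerA (trN r) p + cornerA (trE r) p + cornerA (trN (trE r)) p
      = stInd y p - stInd x p) ∧
  (∀ p, cornerB r p + cornerB (trN r) p + cornerB (trE r) p + cornerB (trN (trE r)) p
      = stInd x p - stInd y p)

/-- the canonical (normalized) representative of each `{r, Nr, Er, NEr}`
equivalence class: west and south coordinates lie in the first fundamental domain -/
def normal4 {n : ℕ} (r : Rect (2 * n)) : Prop := r.cW.val < n ∧ r.rS.val < n

instance {n : ℕ} (r : Rect (2 * n)) : Decidable (normal4 r) :=
  inferInstanceAs (Decidable (_ ∧ _))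

/-- `O_i[r₄]`: total multiplicity of `r₄` at the four lifts of `O_i` -/
def O4count {n : ℕ} [NeZero n] (G : GridDiagram n) (r : Rect (2 * n)) (i : ZMod n) : ℕ :=
  ∑ p : ZMod (2 * n) × ZMod (2 * n),
    if pr p.1 = i ∧ pr p.2 = G.Orow i then r.mult p else 0

/-- `X_i[r₄]` -/
def X4count {n : ℕ} [NeZero n] (G : GridDiagram n) (r : Rect (2 * n)) (i : ZMod n) : ℕ :=
  ∑ p : ZMod (2 * n) × ZMod (2 * n),
    if pr p.1 = i ∧ pr p.2 = G.Xrow i then r.mult p else 0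

/-- `r₄ ∩ π₄⁻¹(𝕏) = ∅` -/
def XDisjoint4 {n : ℕ} [NeZero n] (G : GridDiagram n) (r : Rect (2 * n)) : Prop :=
  ∀ i, X4count G r i = 0

/-- point-measure of a domain (an integer-valued multiplicity function on the
squares of `𝔾₄`) at the lifted grid state `w₄` -/
def pm4 {n : ℕ} [NeZero n] (w : GridState n) (ψ : ZMod (2 * n) × ZMod (2 * n) → ℤ) : ℚ :=
  (∑ p : ZMod (2 * n) × ZMod (2 * n),
    if w (pr p.1) = pr p.2 then
      ((ψ (p.1 - 1, p.2 - 1) + ψ (p.1, p.2 - 1) + ψ (p.1 - 1, p.2) + ψ p : ℤ) : ℚ)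
    else 0) / 4

/-- a rectangle of `𝔾₄` viewed as a domain -/
def Rect.dom4 {n : ℕ} (r : Rect (2 * n)) : ZMod (2 * n) × ZMod (2 * n) → ℤ :=
  fun p => (r.mult p : ℤ)

/-- point-measure `p_{w₄}[r₄]` of a rectangle of `𝔾₄` -/
def rpm4 {n : ℕ} [NeZero n] (w : GridState n) (r : Rect (2 * n)) : ℚ :=
  pm4 w r.dom4

/-- `m[r₄] = (p_{x₄}[r₄] + p_{y₄}[r₄] − 1)/2`, as a rational number -/
def mQ4 {n : ℕ} [NeZero n] (x y : GridState n) (r : Rect (2 * n)) : ℚ :=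
  (rpm4 x r + rpm4 y r - 1) / 2

/-- `m[r₄]` as a natural number (the exponent of `v`) -/
def m4 {n : ℕ} [NeZero n] (x y : GridState n) (r : Rect (2 * n)) : ℕ :=
  (⌊mQ4 x y r⌋).toNat

/-! ### Maslov and Alexander gradings (via the planar counting function `J`) -/

/-- the points of a planar fundamental domain associated to `f`, in doubled
coordinates (grid states at even positions, markings at odd positions) -/
def ptsOf {m : ℕ} [NeZero m] (f : ZMod m → ZMod m) (off : ℕ) : Finset (ℕ × ℕ) :=
  Finset.univ.image fun k => (2 * k.val + off, 2 * (f k).val + off)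

/-- `I(P,Q)`: pairs `(p,q)` with `q` strictly above and strictly to the right of `p` -/
def Icnt (P Q : Finset (ℕ × ℕ)) : ℕ :=
  ∑ p ∈ P, (Q.filter fun q => p.1 < q.1 ∧ p.2 < q.2).card

/-- `J(P,Q) = (I(P,Q) + I(Q,P))/2` -/
def Jq (P Q : Finset (ℕ × ℕ)) : ℚ := ((Icnt P Q : ℚ) + (Icnt Q P : ℚ)) / 2

/-- the Maslov-type grading `J(x,x) − 2 J(x,P) + J(P,P) + 1` for markings `P` -/
def MaslovOf {m : ℕ} [NeZero m] (f : ZMod m → ZMod m) (x : GridState m) : ℚ :=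
  Jq (ptsOf (⇑x) 0) (ptsOf (⇑x) 0) - 2 * Jq (ptsOf (⇑x) 0) (ptsOf f 1)
    + Jq (ptsOf f 1) (ptsOf f 1) + 1

/-- the Maslov grading `M(x) = M_𝕆(x)` -/
def MaslovO {m : ℕ} [NeZero m] (G : GridDiagram m) (x : GridState m) : ℚ :=
  MaslovOf G.Orow x

/-- `M_𝕏(x)` -/
def MaslovX {m : ℕ} [NeZero m] (G : GridDiagram m) (x : GridState m) : ℚ :=
  MaslovOf G.Xrow x

/-- the Alexander grading `A(x) = (M_𝕆(x) − M_𝕏(x) − (n−1))/2` -/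
def Alex {m : ℕ} [NeZero m] (G : GridDiagram m) (x : GridState m) : ℚ :=
  (MaslovO G x - MaslovX G x - ((m : ℚ) - 1)) / 2

/-! ### The double-point enhanced grid complex -/

/-- the ring `𝔽[V₁, …, V_n, v]`: `V_i = X (some i)`, `v = X none` -/
abbrev Rng (n : ℕ) : Type := MvPolynomial (Option (ZMod n)) F

/-- the free `𝔽[V₁,…,V_n,v]`-module on the set of grid states; it underlies both
`GC•(𝔾)` and `GC•(𝔾₄)` (their grid states being canonically identified) -/
abbrev GC (n : ℕ) := GridState n →₀ Rng n

/-- the variable `V_i` -/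
def Vv {n : ℕ} (i : ZMod n) : Rng n := MvPolynomial.X (some i)

/-- the double-point variable `v` -/
def vV {n : ℕ} : Rng n := MvPolynomial.X none

/-- the `𝔽[V₁,…,V_n,v]`-linear map determined by values on grid states -/
def basisMap {n : ℕ} (f : GridState n → GC n) : GC n →ₗ[Rng n] GC n :=
  Finsupp.lsum (Rng n) fun x => LinearMap.toSpanSingleton (Rng n) (GC n) (f x)

/-- the weight `V₁^{O₁[r₄]} ⋯ V_n^{O_n[r₄]} v^{m[r₄]}` of a rectangle of `𝔾₄` -/
def wt4 {n : ℕ} [NeZero n] (G : GridDiagram n) (x y : GridState n) (r : Rect (2 * n)) :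
    Rng n :=
  (∏ i : ZMod n, Vv i ^ O4count G r i) * vV ^ m4 x y r

/-- the differential `∂₄•` of `GC•(𝔾₄)`: counts `N,E`-equivalence classes of
rectangles (via their normalized representatives) disjoint from `π₄⁻¹(𝕏)` -/
def diff4 {n : ℕ} [NeZero n] (G : GridDiagram n) : GC n →ₗ[Rng n] GC n :=
  basisMap fun x => ∑ y : GridState n,
    ∑ r ∈ Finset.univ.filter
        (fun r : Rect (2 * n) => IsRect4From x y r ∧ normal4 r ∧ XDisjoint4 G r),
      Finsupp.single y (wt4 G x y r)

/-- the weight of a rectangle of `𝔾` -/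
def wtB {n : ℕ} [NeZero n] (G : GridDiagram n) (x : GridState n) (r : Rect n) : Rng n :=
  (∏ i : ZMod n, Vv i ^ Ocount G r i) * vV ^ Rect.intCount x r

/-- the differential `∂•` of the double-point enhanced grid complex `GC•(𝔾)` -/
def diffB {n : ℕ} [NeZero n] (G : GridDiagram n) : GC n →ₗ[Rng n] GC n :=
  basisMap fun x => ∑ y : GridState n,
    ∑ r ∈ Finset.univ.filter
        (fun r : Rect n => IsRectFrom x y r ∧ XDisjoint G r),
      Finsupp.single y (wtB G x r)

/-- `z` is homogeneous of bidegree `(d, s)` for the (Maslov, Alexander) bigrading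
extended by `M(V₁^{k₁}⋯V_n^{k_n} v^m ⋅ x) = M(x) − 2Σkᵢ + 2m`,
`A(V₁^{k₁}⋯V_n^{k_n} v^m ⋅ x) = A(x) − Σkᵢ`. -/
def IsHomog {n : ℕ} [NeZero n] (G : GridDiagram n) (z : GC n) (d s : ℚ) : Prop :=
  ∀ (y : GridState n) (k : Option (ZMod n) →₀ ℕ), MvPolynomial.coeff k (z y) ≠ 0 →
    (MaslovO G y - 2 * ∑ i : ZMod n, (k (some i) : ℚ) + 2 * (k none : ℚ) = d) ∧
    (Alex G y - ∑ i : ZMod n, (k (some i) : ℚ) = s)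

/-- a linear map is homogeneous of degree `(a, b)` -/
def MapHomog {n : ℕ} [NeZero n] (G G' : GridDiagram n) (φ : GC n →ₗ[Rng n] GC n)
    (a b : ℚ) : Prop :=
  ∀ z d s, IsHomog G z d s → IsHomog G' (φ z) (d + a) (s + b)

/-- `𝔾` represents a knot: following the link (column `i` joins its `O` to the `X`
in the same row, etc.) visits every column -/
def IsKnot {n : ℕ} (G : GridDiagram n) : Prop :=
  ∀ i j : ZMod n, ∃ k : ℕ,
    (((Equiv.ofBijective G.Orow G.hO).trans (Equiv.ofBijective G.Xrow G.hX).symm) ^ k) i = j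

/-- the homotopy operator `𝓗_{X_j}•` counting equivalence classes of rectangles in
`𝔾₄` crossing the lifts of `X_j` exactly once and no other `X`-marking -/
def HXmap {n : ℕ} [NeZero n] (G : GridDiagram n) (j : ZMod n) : GC n →ₗ[Rng n] GC n :=
  basisMap fun x => ∑ y : GridState n,
    ∑ r ∈ Finset.univ.filter (fun r : Rect (2 * n) =>
        IsRect4From x y r ∧ normal4 r ∧ X4count G r j = 1 ∧
        ∀ k, k ≠ j → X4count G r k = 0),
      Finsupp.single y (wt4 G x y r)

/-! ### Commutation moves, pentagons and hexagons

`𝔾` and `𝔾'` differ by commuting the (adjacent) columns `c−1` and `c`; they are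
drawn on a common torus, sharing all markings and all circles except that the
vertical circle `β_c` of `𝔾` is replaced in `𝔾'` by a curve `γ_c` which passes
to the west of the marking line within the rows of the cyclic interval
`J = [h₁, h₂)` (which contains the markings of column `c−1`) and to the east of
it in the complementary rows (which contain the markings of column `c`);
`γ_c` crosses `β_c` at two points `a` (just south of the row-circle `h₂`) and
`b` (just south of `h₁`).  Grid states of `𝔾'` are again recorded as
permutations (the `γ`-point in row `j` replacing the `β_c`-point). -/

structure CommData (n : ℕ) where
  G : GridDiagram n
  G' : GridDiagram n
  c : ZMod n
  h₁ : ZMod n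
  h₂ : ZMod n
  hne : h₁ ≠ h₂
  hOA : inIco h₁ h₂ (G.Orow (c - 1))
  hXA : inIco h₁ h₂ (G.Xrow (c - 1))
  hOB : ¬ inIco h₁ h₂ (G.Orow c)
  hXB : ¬ inIco h₁ h₂ (G.Xrow c)
  hO'A : G'.Orow (c - 1) = G.Orow c
  hO'B : G'.Orow c = G.Orow (c - 1)
  hX'A : G'.Xrow (c - 1) = G.Xrow c
  hX'B : G'.Xrow c = G.Xrow (c - 1)
  hO' : ∀ k, k ≠ c - 1 → k ≠ c → G'.Orow k = G.Orow k
  hX' : ∀ k, k ≠ c - 1 → k ≠ c → G'.Xrow k = G.Xrow k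

/-- Pentagon data in the 4-fold torus `T₄`: the underlying rectangle
`I₄(p)` of `𝔾₄`, the side of the curved edge (`left = true` means the curved
vertical edge is the east edge of the rectangle), and the lifted height `hh`
of the crossing point (`a` or `b`) serving as the fifth corner. -/
structure Pent (n : ℕ) where
  rect : Rect (2 * n)
  left : Bool
  hh : ZMod (2 * n)
deriving DecidableEq

instance (n : ℕ) [NeZero n] : Fintype (Pent n) :=
  Fintype.ofEquiv (Rect (2 * n) × Bool × ZMod (2 * n))
    { toFun := fun p => ⟨p.1, p.2.1, p.2.2⟩
      invFun := fun p => ⟨p.rect, p.left, p.hh⟩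
      left_inv := fun _ => rfl
      right_inv := fun _ => rfl }

/-- the distinguished vertical edge lies on a lift of the curved circle -/
def onCedge {n : ℕ} (C : CommData n) (p : Pent n) : Prop :=
  if p.left then pr p.rect.cE = C.c else pr p.rect.cW = C.c

/-- the crossing point (at height just below the row circle `h`) lies strictly
inside the vertical extent of the rectangle -/
def heightOK {n : ℕ} (r : Rect (2 * n)) (h : ZMod (2 * n)) : Prop :=
  0 < (h - r.rS).val ∧ (h - r.rS).val ≤ (r.rN - r.rS).val

/-- a pentagon from `x₄ ∈ S₄(𝔾₄)` to `y₄' ∈ S₄(𝔾₄')` (with fifth corner at a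
lift of the distinguished point `a`) -/
def IsPentA {n : ℕ} (C : CommData n) (x y' : GridState n) (p : Pent n) : Prop :=
  IsRect4From x y' p.rect ∧ pr p.hh = C.h₂ ∧ onCedge C p ∧ heightOK p.rect p.hh

/-- a pentagon from `y₄' ∈ S₄(𝔾₄')` to `x₄ ∈ S₄(𝔾₄)` (fifth corner at a lift of `b`) -/
def IsPentB {n : ℕ} (C : CommData n) (y' x : GridState n) (p : Pent n) : Prop :=
  IsRect4From y' x p.rect ∧ pr p.hh = C.h₁ ∧ onCedge C p ∧ heightOK p.rect p.hh

/-- the rows along which the boundary of the pentagon runs along `γ` rather than `β_c` -/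
def detourA {n : ℕ} [NeZero n] (p : Pent n) : Finset (ZMod (2 * n)) :=
  if p.left then Finset.univ.filter (fun j => inIco p.rect.rS p.hh j)
  else Finset.univ.filter (fun j => inIco p.hh p.rect.rN j)

def detourB {n : ℕ} [NeZero n] (p : Pent n) : Finset (ZMod (2 * n)) :=
  if p.left then Finset.univ.filter (fun j => inIco p.hh p.rect.rN j)
  else Finset.univ.filter (fun j => inIco p.rect.rS p.hh j)

/-- marking-count correction along a curved edge: in a detour row `j`, if `γ` is
west (`π₄ j ∈ J`) the bigon sliver carries the column-`(c−1)` marking, otherwise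
it carries the column-`c` marking; the sliver is gained or lost according to
whether the region lies east (`east = true`) or west of the curved circle. -/
def adj {n : ℕ} [NeZero n] (C : CommData n) (f : ZMod n → ZMod n) (east : Bool)
    (D : Finset (ZMod (2 * n))) (i : ZMod n) : ℤ :=
  ∑ j ∈ D,
    if inIco C.h₁ C.h₂ (pr j) then
      (if i = C.c - 1 ∧ f (C.c - 1) = pr j then (if east then 1 else -1) else 0)
    else
      (if i = C.c ∧ f C.c = pr j then (if east then -1 else 1) else 0)

/-- `O_i[p₄]` for a pentagon counted by `P•` -/
def pentOA {n : ℕ} [NeZero n] (C : CommData n) (p : Pent n) (i : ZMod n) : ℤ :=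
  (O4count C.G p.rect i : ℤ) + adj C C.G.Orow (!p.left) (detourA p) i

def pentXA {n : ℕ} [NeZero n] (C : CommData n) (p : Pent n) (i : ZMod n) : ℤ :=
  (X4count C.G p.rect i : ℤ) + adj C C.G.Xrow (!p.left) (detourA p) i

def pentXDisjA {n : ℕ} [NeZero n] (C : CommData n) (p : Pent n) : Prop :=
  ∀ i, pentXA C p i = 0

def pentOB {n : ℕ} [NeZero n] (C : CommData n) (p : Pent n) (i : ZMod n) : ℤ :=
  (O4count C.G p.rect i : ℤ) + adj C C.G.Orow (!p.left) (detourB p) i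

def pentXB {n : ℕ} [NeZero n] (C : CommData n) (p : Pent n) (i : ZMod n) : ℤ :=
  (X4count C.G p.rect i : ℤ) + adj C C.G.Xrow (!p.left) (detourB p) i

def pentXDisjB {n : ℕ} [NeZero n] (C : CommData n) (p : Pent n) : Prop :=
  ∀ i, pentXB C p i = 0

/-- the weight `V₁^{O₁[p₄]}⋯V_n^{O_n[p₄]} v^{m[p₄]}`, with `m[p₄] = m[I₄(p₄)]` -/
def pentWtA {n : ℕ} [NeZero n] (C : CommData n) (x y' : GridState n) (p : Pent n) : Rng n :=
  (∏ i : ZMod n, Vv i ^ (pentOA C p i).toNat) * vV ^ m4 x y' p.rect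

def pentWtB {n : ℕ} [NeZero n] (C : CommData n) (y' x : GridState n) (p : Pent n) : Rng n :=
  (∏ i : ZMod n, Vv i ^ (pentOB C p i).toNat) * vV ^ m4 y' x p.rect

/-- the pentagon-counting map `P• : GC•(𝔾₄) → GC•(𝔾₄')` -/
def Pmap {n : ℕ} [NeZero n] (C : CommData n) : GC n →ₗ[Rng n] GC n :=
  basisMap fun x => ∑ y' : GridState n,
    ∑ p ∈ Finset.univ.filter (fun p : Pent n =>
        IsPentA C x y' p ∧ normal4 p.rect ∧ pentXDisjA C p),
      Finsupp.single y' (pentWtA C x y' p)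

/-- the pentagon-counting map `(P•)' : GC•(𝔾₄') → GC•(𝔾₄)` -/
def P'map {n : ℕ} [NeZero n] (C : CommData n) : GC n →ₗ[Rng n] GC n :=
  basisMap fun y' => ∑ x : GridState n,
    ∑ p ∈ Finset.univ.filter (fun p : Pent n =>
        IsPentB C y' x p ∧ normal4 p.rect ∧ pentXDisjB C p),
      Finsupp.single x (pentWtB C y' x p)

/-- Hexagon data: the underlying rectangle `I₄(h₄)` of `𝔾₄`, the side of its
curved edge, and the lifted heights of its two crossing-point corners
(`ha` a lift of `a`, `hb` a lift of `b`). -/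
structure Hex (n : ℕ) where
  rect : Rect (2 * n)
  left : Bool
  ha : ZMod (2 * n)
  hb : ZMod (2 * n)
deriving DecidableEq

instance (n : ℕ) [NeZero n] : Fintype (Hex n) :=
  Fintype.ofEquiv (Rect (2 * n) × Bool × ZMod (2 * n) × ZMod (2 * n))
    { toFun := fun p => ⟨p.1, p.2.1, p.2.2.1, p.2.2.2⟩
      invFun := fun p => ⟨p.rect, p.left, p.ha, p.hb⟩
      left_inv := fun _ => rfl
      right_inv := fun _ => rfl }

def onCedgeH {n : ℕ} (C : CommData n) (h : Hex n) : Prop :=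
  if h.left then pr h.rect.cE = C.c else pr h.rect.cW = C.c

/-- a hexagon from `x₄` to `y₄` (both states of `𝔾₄`) -/
def IsHex {n : ℕ} (C : CommData n) (x y : GridState n) (h : Hex n) : Prop :=
  IsRect4From x y h.rect ∧ pr h.ha = C.h₂ ∧ pr h.hb = C.h₁ ∧ onCedgeH C h ∧
  heightOK h.rect h.ha ∧ heightOK h.rect h.hb

/-- the rows between the two crossing-point corners of a hexagon -/
def detourH {n : ℕ} [NeZero n] (h : Hex n) : Finset (ZMod (2 * n)) :=
  if (h.ha - h.rect.rS).val < (h.hb - h.rect.rS).val then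
    Finset.univ.filter (fun j => inIco h.ha h.hb j)
  else Finset.univ.filter (fun j => inIco h.hb h.ha j)

def hexO {n : ℕ} [NeZero n] (C : CommData n) (h : Hex n) (i : ZMod n) : ℤ :=
  (O4count C.G h.rect i : ℤ) + adj C C.G.Orow (!h.left) (detourH h) i

def hexX {n : ℕ} [NeZero n] (C : CommData n) (h : Hex n) (i : ZMod n) : ℤ :=
  (X4count C.G h.rect i : ℤ) + adj C C.G.Xrow (!h.left) (detourH h) i

def hexXDisj {n : ℕ} [NeZero n] (C : CommData n) (h : Hex n) : Prop :=
  ∀ i, hexX C h i = 0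

def hexWt {n : ℕ} [NeZero n] (C : CommData n) (x y : GridState n) (h : Hex n) : Rng n :=
  (∏ i : ZMod n, Vv i ^ (hexO C h i).toNat) * vV ^ m4 x y h.rect

/-- the hexagon-counting map `H• : GC•(𝔾₄) → GC•(𝔾₄)` -/
def Hmap {n : ℕ} [NeZero n] (C : CommData n) : GC n →ₗ[Rng n] GC n :=
  basisMap fun x => ∑ y : GridState n,
    ∑ h ∈ Finset.univ.filter (fun h : Hex n =>
        IsHex C x y h ∧ normal4 h.rect ∧ hexXDisj C h),
      Finsupp.single y (hexWt C x y h)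

/-! ### Double-point enhanced grid homology -/

def cycles {n : ℕ} [NeZero n] (G : GridDiagram n) : Submodule (Rng n) (GC n) :=
  LinearMap.ker (diffB G)

def bdrIn {n : ℕ} [NeZero n] (G : GridDiagram n) : Submodule (Rng n) ↥(cycles G) :=
  Submodule.comap (cycles G).subtype (LinearMap.range (diffB G))

instance GHquotInst {n : ℕ} [NeZero n] (G : GridDiagram n) :
    HasQuotient ↥(cycles G) (Submodule (Rng n) ↥(cycles G)) :=
  Submodule.hasQuotient (R := Rng n) (M := ↥(cycles G))

/-- the double-point enhanced grid homology `GH•(𝔾)` -/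
abbrev GH {n : ℕ} [NeZero n] (G : GridDiagram n) := ↥(cycles G) ⧸ bdrIn G

/-- a homology class is homogeneous of degree `(d,s)` if it has a homogeneous
cycle representative -/
def GHhomog {n : ℕ} [NeZero n] (G : GridDiagram n) (h : GH G) (d s : ℚ) : Prop :=
  ∃ w : ↥(cycles G), (Submodule.Quotient.mk w : GH G) = h ∧ IsHomog G (w : GC n) d s

/-! ### Commutation and stabilization moves as relations on grid diagrams -/

/-- `𝔾` and `𝔾'` differ by a column commutation move -/
def IsColComm {n : ℕ} (G G' : GridDiagram n) : Prop :=
  ∃ C : CommData n, C.G = G ∧ C.G' = G'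

/-- the transposed grid diagram (exchanging the roles of rows and columns) -/
def GridDiagram.transpose {n : ℕ} (G : GridDiagram n) : GridDiagram n where
  Orow := ⇑(Equiv.ofBijective G.Orow G.hO).symm
  Xrow := ⇑(Equiv.ofBijective G.Xrow G.hX).symm
  hO := (Equiv.ofBijective G.Orow G.hO).symm.bijective
  hX := (Equiv.ofBijective G.Xrow G.hX).symm.bijective
  hOX := by
    intro i h
    apply G.hOX ((Equiv.ofBijective G.Orow G.hO).symm i)
    have h1 : G.Orow ((Equiv.ofBijective G.Orow G.hO).symm i) = i :=
      Equiv.ofBijective_apply_symm_apply G.Orow G.hO i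
    have h2 : G.Xrow ((Equiv.ofBijective G.Xrow G.hX).symm i) = i :=
      Equiv.ofBijective_apply_symm_apply G.Xrow G.hX i
    rw [h1, h, h2]

/-- `𝔾` and `𝔾'` differ by a row commutation move -/
def IsRowComm {n : ℕ} (G G' : GridDiagram n) : Prop :=
  IsColComm G.transpose G'.transpose

/-- collapse map identifying `a` and `a+1` (used to destabilize) -/
def coll {n : ℕ} (a k : ZMod (n + 1)) : ZMod n :=
  (a.val : ZMod n) + (((k - a).val - 1 : ℕ) : ZMod n)

/-- `𝔾'` is obtained from `𝔾` by a stabilization with new 2×2 block at columns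
`c', c'+1` and rows `r', r'+1`; the empty square of the block sits at the corner
selected by `(ec, er)` (east column?, north row?), and `xty` records whether the
block carries two `X`-markings (type `X:·`) or two `O`-markings (type `O:·`).
E.g. `(ec, er, xty) = (false, false, true)` is type `X:SW`, with
`O₁ = (c'+1, r'+1)`, `X₁ = (c', r'+1)`, `X₂ = (c'+1, r')`. -/
def IsStabAt {n : ℕ} (G : GridDiagram n) (G' : GridDiagram (n + 1))
    (c' r' : ZMod (n + 1)) (ec er xty : Bool) : Prop :=
  (if xty then
    G'.Orow (if ec then c' else c' + 1) = (if er then r' else r' + 1) ∧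
    G'.Xrow (if ec then c' + 1 else c') = (if er then r' else r' + 1) ∧
    G'.Xrow (if ec then c' else c' + 1) = (if er then r' + 1 else r') ∧
    G.Xrow (c'.val : ZMod n) = (r'.val : ZMod n) ∧
    G.Orow (c'.val : ZMod n) = coll r' (G'.Orow (if ec then c' + 1 else c'))
  else
    G'.Xrow (if ec then c' else c' + 1) = (if er then r' else r' + 1) ∧
    G'.Orow (if ec then c' + 1 else c') = (if er then r' else r' + 1) ∧
    G'.Orow (if ec then c' else c' + 1) = (if er then r' + 1 else r') ∧
    G.Orow (c'.val : ZMod n) = (r'.val : ZMod n) ∧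
    G.Xrow (c'.val : ZMod n) = coll r' (G'.Xrow (if ec then c' + 1 else c'))) ∧
  (∀ k : ZMod (n + 1), k ≠ c' → k ≠ c' + 1 →
    G.Orow (coll c' k) = coll r' (G'.Orow k) ∧ G.Xrow (coll c' k) = coll r' (G'.Xrow k))

/-- `𝔾'` is obtained from `𝔾` by a stabilization move of one of the standard types -/
def IsStab {n : ℕ} (G : GridDiagram n) (G' : GridDiagram (n + 1)) : Prop :=
  ∃ c' r' ec er xty, IsStabAt G G' c' r' ec er xty

/-! ### The stabilization machinery (type `X:SW`) for the 4-fold complexes -/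

/-- projection of `GC•(𝔾₄')` onto the span `I₄` of states containing the
distinguished point `c = (c'+1, r'+1)` -/
def pI {n : ℕ} (c' r' : ZMod (n + 1)) : GC (n + 1) →ₗ[Rng (n + 1)] GC (n + 1) :=
  basisMap fun x => if x (c' + 1) = r' + 1 then Finsupp.single x 1 else 0

/-- projection onto the complementary span `N₄` -/
def pN {n : ℕ} (c' r' : ZMod (n + 1)) : GC (n + 1) →ₗ[Rng (n + 1)] GC (n + 1) :=
  basisMap fun x => if x (c' + 1) = r' + 1 then 0 else Finsupp.single x 1

/-- the submodule `I₄` -/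
def Isub {n : ℕ} (c' r' : ZMod (n + 1)) : Submodule (Rng (n + 1)) (GC (n + 1)) :=
  Finsupp.supported (Rng (n + 1)) (Rng (n + 1)) {x : GridState (n + 1) | x (c' + 1) = r' + 1}

/-- the submodule `N₄` -/
def Nsub {n : ℕ} (c' r' : ZMod (n + 1)) : Submodule (Rng (n + 1)) (GC (n + 1)) :=
  Finsupp.supported (Rng (n + 1)) (Rng (n + 1)) {x : GridState (n + 1) | x (c' + 1) ≠ r' + 1}

/-- the components `∂_{I₄}^{I₄}`, `∂_{I₄}^{N₄}`, `∂_{N₄}^{N₄}` of `∂₄•` -/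
def dII {n : ℕ} [NeZero (n + 1)] (G' : GridDiagram (n + 1)) (c' r' : ZMod (n + 1)) :
    GC (n + 1) →ₗ[Rng (n + 1)] GC (n + 1) :=
  pI c' r' ∘ₗ diff4 G' ∘ₗ pI c' r'

def dIN {n : ℕ} [NeZero (n + 1)] (G' : GridDiagram (n + 1)) (c' r' : ZMod (n + 1)) :
    GC (n + 1) →ₗ[Rng (n + 1)] GC (n + 1) :=
  pN c' r' ∘ₗ diff4 G' ∘ₗ pI c' r'

def dNN {n : ℕ} [NeZero (n + 1)] (G' : GridDiagram (n + 1)) (c' r' : ZMod (n + 1)) :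
    GC (n + 1) →ₗ[Rng (n + 1)] GC (n + 1) :=
  pN c' r' ∘ₗ diff4 G' ∘ₗ pN c' r'

/-- section of the column collapse map, avoiding the new column `c'+1` -/
def sect {n : ℕ} (a : ZMod (n + 1)) (k : ZMod n) : ZMod (n + 1) :=
  a + (if k - (a.val : ZMod n) = 0 then 0
       else (((k - (a.val : ZMod n)).val + 1 : ℕ) : ZMod (n + 1)))

def stCollFun {n : ℕ} (c' r' : ZMod (n + 1)) (x : GridState (n + 1)) :
    ZMod n → ZMod n :=
  fun k => coll r' (x (sect c' k))

/-- the destabilized grid state `x` corresponding to `x' = x ∪ {c}` -/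
def stColl {n : ℕ} (c' r' : ZMod (n + 1)) (x : GridState (n + 1)) : GridState n :=
  if h : Function.Bijective (stCollFun c' r' x) then Equiv.ofBijective _ h else 1

/-- the promoted module `GC•(𝔾₄)[V₁]`: the free `𝔽[V₁,…,V_n,v]`-module on the
grid states of the destabilized diagram -/
abbrev GCP (n : ℕ) := GridState n →₀ Rng (n + 1)

def basisMapP {n : ℕ} (f : GridState n → GCP n) : GCP n →ₗ[Rng (n + 1)] GCP n :=
  Finsupp.lsum (Rng (n + 1)) fun x => LinearMap.toSpanSingleton (Rng (n + 1)) (GCP n) (f x)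

/-- the identification `e₄` (extended by zero on `N₄`) -/
def e4map {n : ℕ} (c' r' : ZMod (n + 1)) : GC (n + 1) →ₗ[Rng (n + 1)] GCP n :=
  Finsupp.lsum (Rng (n + 1)) fun x =>
    LinearMap.toSpanSingleton (Rng (n + 1)) (GCP n)
      (if x (c' + 1) = r' + 1 then Finsupp.single (stColl c' r' x) (1 : Rng (n + 1)) else 0)

/-- renaming of the variables of the destabilized diagram into those of `𝔾'` -/
def renUp {n : ℕ} (c' : ZMod (n + 1)) : Rng n →+* Rng (n + 1) :=
  (MvPolynomial.rename (Option.map (sect c')) :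
      MvPolynomial (Option (ZMod n)) F →ₐ[F] MvPolynomial (Option (ZMod (n + 1))) F).toRingHom

/-- the differential of the promoted complex `GC•(𝔾₄)[V₁]` -/
def diffP {n : ℕ} [NeZero n] (G : GridDiagram n) (c' : ZMod (n + 1)) :
    GCP n →ₗ[Rng (n + 1)] GCP n :=
  basisMapP fun x => ∑ y : GridState n,
    ∑ r ∈ Finset.univ.filter
        (fun r : Rect (2 * n) => IsRect4From x y r ∧ normal4 r ∧ XDisjoint4 G r),
      Finsupp.single y (renUp c' (wt4 G x y r))

/-- homogeneity on the promoted complex -/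
def IsHomogP {n : ℕ} [NeZero n] (G : GridDiagram n) (z : GCP n) (d s : ℚ) : Prop :=
  ∀ (y : GridState n) (k : Option (ZMod (n + 1)) →₀ ℕ), MvPolynomial.coeff k (z y) ≠ 0 →
    (MaslovO G y - 2 * ∑ i : ZMod (n + 1), (k (some i) : ℚ) + 2 * (k none : ℚ) = d) ∧
    (Alex G y - ∑ i : ZMod (n + 1), (k (some i) : ℚ) = s)

/-- the map counting equivalence classes of rectangles crossing `X₂` (the
`X`-marking of column `c'+1`) once and no other `X`-marking -/
def HX2map {n : ℕ} (G' : GridDiagram (n + 1)) (c' : ZMod (n + 1)) :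
    GC (n + 1) →ₗ[Rng (n + 1)] GC (n + 1) :=
  basisMap fun x => ∑ y : GridState (n + 1),
    ∑ r ∈ Finset.univ.filter (fun r : Rect (2 * (n + 1)) =>
        IsRect4From x y r ∧ normal4 r ∧ X4count G' r (c' + 1) = 1 ∧
        ∀ k, k ≠ c' + 1 → X4count G' r k = 0),
      Finsupp.single y (wt4 G' x y r)

/-- its component `𝓗_{X₂}^{I₄} : N₄ → I₄` -/
def hX2I {n : ℕ} (G' : GridDiagram (n + 1)) (c' r' : ZMod (n + 1)) :
    GC (n + 1) →ₗ[Rng (n + 1)] GC (n + 1) :=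
  pI c' r' ∘ₗ HX2map G' c' ∘ₗ pN c' r'

/-- weight with the variable `V_j` evaluated at `1` -/
def wtNo {n : ℕ} [NeZero n] (G : GridDiagram n) (x y : GridState n) (j : ZMod n)
    (r : Rect (2 * n)) : Rng n :=
  (∏ i ∈ Finset.univ.erase j, Vv i ^ O4count G r i) * vV ^ m4 x y r

/-- `𝓗_{O₁}•`: counts `X`-disjoint rectangles crossing `O₁` (the `O`-marking of
column `c'+1`) once, with `V₁` evaluated at `1` -/
def HO1map {n : ℕ} (G' : GridDiagram (n + 1)) (c' : ZMod (n + 1)) :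
    GC (n + 1) →ₗ[Rng (n + 1)] GC (n + 1) :=
  basisMap fun x => ∑ y : GridState (n + 1),
    ∑ r ∈ Finset.univ.filter (fun r : Rect (2 * (n + 1)) =>
        IsRect4From x y r ∧ normal4 r ∧ XDisjoint4 G' r ∧ O4count G' r (c' + 1) = 1),
      Finsupp.single y (wtNo G' x y (c' + 1) r)

/-- its component `I₄ → N₄` -/
def hO1N {n : ℕ} (G' : GridDiagram (n + 1)) (c' r' : ZMod (n + 1)) :
    GC (n + 1) →ₗ[Rng (n + 1)] GC (n + 1) :=
  pN c' r' ∘ₗ HO1map G' c' ∘ₗ pI c' r'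

/-! ### Grid diagrams of arbitrary size, and the moves of Cromwell's theorem -/

/-- a grid diagram of unspecified (positive) grid number -/
structure GDS where
  sz : ℕ+
  D : GridDiagram (sz : ℕ)

instance (p : ℕ+) : NeZero (p : ℕ) := ⟨p.ne_zero⟩

/-- a single commutation or stabilization move -/
def MoveRel (A B : GDS) : Prop :=
  (∃ h : (A.sz : ℕ) = (B.sz : ℕ),
      IsColComm (h ▸ A.D) B.D ∨ IsRowComm (h ▸ A.D) B.D) ∨
  (∃ h : (B.sz : ℕ) = (A.sz : ℕ) + 1, IsStab A.D (h ▸ B.D))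

/-- connected by a finite sequence of commutation moves and
stabilization/destabilization moves -/
def ConnectedByMoves (A B : GDS) : Prop :=
  Relation.ReflTransGen (fun X Y => MoveRel X Y ∨ MoveRel Y X) A B

set_option linter.unusedSimpArgs false
set_option linter.unusedSectionVars false

/-! ### Proof: cyclic intervals -/

theorem val_sub_eq {m : ℕ} [NeZero m] (k u : ZMod m) :
    (u.val ≤ k.val ∧ (k - u).val = k.val - u.val) ∨
    (k.val < u.val ∧ (k - u).val + u.val = k.val + m) := by
  by_cases h : u.val ≤ k.val
  · exact Or.inl ⟨h, ZMod.val_sub h⟩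
  · right
    push Not at h
    refine ⟨h, ?_⟩
    have h1 : (u - k).val = u.val - k.val := ZMod.val_sub h.le
    have hne : u - k ≠ 0 := by
      intro h0
      rw [h0, ZMod.val_zero] at h1
      omega
    have : NeZero (u - k) := ⟨hne⟩
    have h2 : (-(u - k)).val = m - (u - k).val := ZMod.val_neg_of_ne_zero (u - k)
    rw [neg_sub] at h2
    have := ZMod.val_lt u
    omega

theorem inIco_iff {m : ℕ} [NeZero m] (u v k : ZMod m) :
    inIco u v k ↔ (u.val ≤ k.val ∧ k.val < v.val) ∨
      (v.val < u.val ∧ (u.val ≤ k.val ∨ k.val < v.val)) := by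
  unfold inIco
  have h1 := val_sub_eq k u
  have h2 := val_sub_eq v u
  have := ZMod.val_lt u
  have := ZMod.val_lt v
  have := ZMod.val_lt k
  omega

theorem inIoo_iff_ne {m : ℕ} [NeZero m] (u v k : ZMod m) :
    inIoo u v k ↔ k ≠ u ∧ inIco u v k := by
  unfold inIoo inIco
  have : 0 < (k - u).val ↔ k ≠ u := by
    rw [Nat.pos_iff_ne_zero, Ne, ZMod.val_eq_zero, sub_eq_zero]
  rw [this]

theorem inIoo_iff {m : ℕ} [NeZero m] (u v k : ZMod m) :
    inIoo u v k ↔ (u.val < k.val ∧ k.val < v.val) ∨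
      (v.val < u.val ∧ (u.val < k.val ∨ k.val < v.val)) := by
  rw [inIoo_iff_ne, inIco_iff, Ne, ← (ZMod.val_injective m).eq_iff]
  omega

theorem val_ne {m : ℕ} [NeZero m] {u v : ZMod m} (h : u ≠ v) : u.val ≠ v.val :=
  fun h' => h (ZMod.val_injective m h')

theorem inIoo_left {m : ℕ} [NeZero m] (u v : ZMod m) : ¬ inIoo u v u := by
  rw [inIoo_iff]; omega

theorem inIoo_right {m : ℕ} [NeZero m] (u v : ZMod m) : ¬ inIoo u v v := by
  rw [inIoo_iff]; omega

/-- splitting a cyclic interval at an interior point -/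
theorem inIco_split {m : ℕ} [NeZero m] {a b e : ZMod m} (h : inIoo a e b) (k : ZMod m) :
    (inIco a e k ↔ inIco a b k ∨ inIco b e k) ∧ ¬ (inIco a b k ∧ inIco b e k) := by
  rw [inIoo_iff] at h
  simp only [inIco_iff]
  omega

theorem cyc_rot {m : ℕ} [NeZero m] {a b e : ZMod m} : inIoo a e b ↔ inIoo b a e := by
  simp only [inIoo_iff]
  omega

theorem cyc_not {m : ℕ} [NeZero m] {a b e : ZMod m} (h1 : a ≠ b) (h2 : a ≠ e) (h3 : b ≠ e) :
    ¬ inIoo a e b ↔ inIoo a b e := by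
  have h1 := val_ne h1
  have h2 := val_ne h2
  have h3 := val_ne h3
  simp only [inIoo_iff]
  omega

/-! ### Composites of two rectangles -/

/-- the rectangle starting at `x` with west column `a` and east column `b` -/
def Rc {n : ℕ} (x : GridState n) (a b : ZMod n) : Rect n := ⟨a, b, x a, x b⟩

/-- the contribution of a composite to `∂²` -/
def tm {n : ℕ} [NeZero n] (G : GridDiagram n) (x : GridState n) (a b c d : ZMod n) : GC n :=
  if a ≠ b ∧ c ≠ d ∧ XDisjoint G (Rc x a b) ∧ XDisjoint G (Rc (x * Equiv.swap a b) c d) then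
    Finsupp.single (x * Equiv.swap a b * Equiv.swap c d)
      (wtB G x (Rc x a b) * wtB G (x * Equiv.swap a b) (Rc (x * Equiv.swap a b) c d))
  else 0

/-- indicator of an interior point -/
def ii {n : ℕ} (x : GridState n) (a b k : ZMod n) : ℕ :=
  if inIoo a b k ∧ inIoo (x a) (x b) (x k) then 1 else 0

theorem intCount_eq {n : ℕ} [NeZero n] (x : GridState n) (a b : ZMod n) :
    Rect.intCount x (Rc x a b) = ∑ k, ii x a b k := by
  unfold Rect.intCount ii Rc
  rw [Finset.card_filter]

theorem ii_eq_mult {n : ℕ} [NeZero n] (x : GridState n) (a b k : ZMod n) (h : k ≠ a) :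
    ii x a b k = (Rc x a b).mult (k, x k) := by
  unfold ii Rect.mult Rc
  simp only [inIoo_iff_ne]
  have : x k ≠ x a := fun h' => h (x.injective h')
  simp [h]

theorem swap_out {n : ℕ} (x : GridState n) {a b k : ZMod n} (h1 : k ≠ a) (h2 : k ≠ b) :
    (x * Equiv.swap a b) k = x k := by
  rw [Equiv.Perm.mul_apply, Equiv.swap_apply_of_ne_of_ne h1 h2]

theorem swap_l {n : ℕ} (x : GridState n) (a b : ZMod n) :
    (x * Equiv.swap a b) a = x b := by
  rw [Equiv.Perm.mul_apply, Equiv.swap_apply_left]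

theorem swap_r {n : ℕ} (x : GridState n) (a b : ZMod n) :
    (x * Equiv.swap a b) b = x a := by
  rw [Equiv.Perm.mul_apply, Equiv.swap_apply_right]

theorem XDisj_pair {n : ℕ} (G : GridDiagram n) {r1 r2 r1' r2' : Rect n}
    (hm : ∀ sq, r1.mult sq + r2.mult sq = r1'.mult sq + r2'.mult sq) :
    (XDisjoint G r1 ∧ XDisjoint G r2) ↔ (XDisjoint G r1' ∧ XDisjoint G r2') := by
  unfold XDisjoint Xcount
  constructor <;> rintro ⟨h1, h2⟩ <;> constructor <;> intro i <;>
    have := hm (i, G.Xrow i) <;> have := h1 i <;> have := h2 i <;> omega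

theorem tm_eq {n : ℕ} [NeZero n] (G : GridDiagram n) (x : GridState n)
    (S : Finset (ZMod n)) (a b c d a' b' c' d' : ZMod n)
    (hS : a ∈ S ∧ b ∈ S ∧ c ∈ S ∧ a' ∈ S ∧ b' ∈ S ∧ c' ∈ S)
    (hab : a ≠ b) (hcd : c ≠ d) (hab' : a' ≠ b') (hcd' : c' ≠ d')
    (hp : x * Equiv.swap a b * Equiv.swap c d = x * Equiv.swap a' b' * Equiv.swap c' d')
    (hm : ∀ sq, (Rc x a b).mult sq + (Rc (x * Equiv.swap a b) c d).mult sq =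
      (Rc x a' b').mult sq + (Rc (x * Equiv.swap a' b') c' d').mult sq)
    (hi : ∑ k ∈ S, (ii x a b k + ii (x * Equiv.swap a b) c d k) =
      ∑ k ∈ S, (ii x a' b' k + ii (x * Equiv.swap a' b') c' d' k)) :
    tm G x a b c d = tm G x a' b' c' d' := by
  have h_int : Rect.intCount x (Rc x a b) +
      Rect.intCount (x * Equiv.swap a b) (Rc (x * Equiv.swap a b) c d) =
      Rect.intCount x (Rc x a' b') +
      Rect.intCount (x * Equiv.swap a' b') (Rc (x * Equiv.swap a' b') c' d') := by
    simp only [intCount_eq]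
    rw [← Finset.sum_add_distrib, ← Finset.sum_add_distrib,
      ← Finset.sum_add_sum_compl S, ← Finset.sum_add_sum_compl S (fun k => ii x a' b' k + _), hi]
    congr 1
    apply Finset.sum_congr rfl
    intro k hk
    rw [Finset.mem_compl] at hk
    obtain ⟨h1, h2, h3, h1', h2', h3'⟩ := hS
    have e : ∀ s ∈ S, k ≠ s := fun s hs h => hk (h ▸ hs)
    rw [ii_eq_mult _ _ _ _ (e _ h1), ii_eq_mult _ _ _ _ (e _ h3), ii_eq_mult _ _ _ _ (e _ h1'),
      ii_eq_mult _ _ _ _ (e _ h3'), swap_out _ (e _ h1) (e _ h2), swap_out _ (e _ h1') (e _ h2')]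
    exact hm _
  have hX := XDisj_pair G hm
  unfold tm
  rw [hp]
  have hw : wtB G x (Rc x a b) * wtB G (x * Equiv.swap a b) (Rc (x * Equiv.swap a b) c d) =
      wtB G x (Rc x a' b') * wtB G (x * Equiv.swap a' b') (Rc (x * Equiv.swap a' b') c' d') := by
    unfold wtB
    rw [mul_mul_mul_comm, mul_mul_mul_comm (∏ i, Vv i ^ Ocount G (Rc x a' b') i),
      ← Finset.prod_mul_distrib, ← Finset.prod_mul_distrib, ← pow_add, ← pow_add, h_int]
    congr 1
    apply Finset.prod_congr rfl
    intro i _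
    rw [← pow_add, ← pow_add]
    unfold Ocount
    rw [hm]
  rw [hw]
  simp only [ne_eq, hab, hcd, hab', hcd', not_false_eq_true, true_and, hX]

theorem tm_zero {n : ℕ} [NeZero n] (G : GridDiagram n) (x : GridState n)
    (a b c d i : ZMod n)
    (h : (Rc x a b).mult (i, G.Xrow i) = 1 ∨
      (Rc (x * Equiv.swap a b) c d).mult (i, G.Xrow i) = 1) :
    tm G x a b c d = 0 := by
  unfold tm
  rw [if_neg]
  rintro ⟨-, -, h1, h2⟩
  have h1 := h1 i
  have h2 := h2 i
  unfold Xcount at h1 h2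
  omega

theorem tm_same {n : ℕ} [NeZero n] (G : GridDiagram n) (x : GridState n) (a b : ZMod n) :
    tm G x a b a b = 0 := by
  by_cases hab : a = b
  · simp [tm, hab]
  apply tm_zero G x a b a b a
  have hx : x a ≠ x b := fun h => hab (x.injective h)
  have h1 := val_ne hab
  have h2 := val_ne hx
  simp only [Rect.mult, Rc, swap_l, swap_r, inIco_iff, ite_eq_left_iff]
  simp
  omega

theorem tm_opp {n : ℕ} [NeZero n] (G : GridDiagram n) (x : GridState n) (a b : ZMod n) :
    tm G x a b b a = 0 := by
  by_cases hab : a = b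
  · simp [tm, hab]
  obtain ⟨i, hi⟩ := G.hX.2 (x a)
  apply tm_zero G x a b b a i
  have hx : x a ≠ x b := fun h => hab (x.injective h)
  have h1 := val_ne hab
  have h2 := val_ne hx
  rw [hi]
  simp only [Rect.mult, Rc, swap_l, swap_r, inIco_iff, ite_eq_left_iff]
  simp
  omega

/-! ### Three columns -/

section three
variable {n : ℕ} [NeZero n] (G : GridDiagram n) (x : GridState n) (a b e : ZMod n)

theorem T1_zero (hab : a ≠ b) (hae : a ≠ e) (hbe : b ≠ e)
    (hR : ¬ inIoo (x a) (x e) (x b)) : tm G x a b a e = 0 := by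
  apply tm_zero G x a b a e a
  have h1 := val_ne hab
  have h2 := val_ne hae
  have h3 := val_ne (x.injective.ne hab)
  have h4 := val_ne (x.injective.ne hae)
  have h5 := val_ne (x.injective.ne hbe)
  rw [inIoo_iff] at hR
  simp only [Rect.mult, Rc, swap_l, swap_r, swap_out x hae.symm hbe.symm, inIco_iff]
  simp
  omega

theorem T2_zero (hab : a ≠ b) (hae : a ≠ e) (hbe : b ≠ e)
    (hC : ¬ inIoo a e b) : tm G x a b e a = 0 := by
  have h1 := val_ne hab
  have h2 := val_ne hae
  have h6 := val_ne hbe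
  have h3 := val_ne (x.injective.ne hab)
  have h4 := val_ne (x.injective.ne hae)
  have h5 := val_ne (x.injective.ne hbe)
  rw [inIoo_iff] at hC
  by_cases hr : inIco (x e) (x b) (x a)
  · obtain ⟨i, hi⟩ := G.hX.2 (x a)
    apply tm_zero G x a b e a i
    rw [inIco_iff] at hr
    rw [hi]
    simp only [Rect.mult, Rc, swap_l, swap_r, swap_out x hae.symm hbe.symm, inIco_iff]
    simp
    omega
  · obtain ⟨i, hi⟩ := G.hX.2 (x e)
    apply tm_zero G x a b e a i
    rw [inIco_iff] at hr
    rw [hi]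
    simp only [Rect.mult, Rc, swap_l, swap_r, swap_out x hae.symm hbe.symm, inIco_iff]
    simp
    omega

theorem T3_zero (hab : a ≠ b) (hae : a ≠ e) (hbe : b ≠ e)
    (hC : ¬ inIoo a e b) : tm G x a b b e = 0 := by
  have h1 := val_ne hab
  have h2 := val_ne hae
  have h6 := val_ne hbe
  have h3 := val_ne (x.injective.ne hab)
  have h4 := val_ne (x.injective.ne hae)
  have h5 := val_ne (x.injective.ne hbe)
  rw [inIoo_iff] at hC
  obtain ⟨i, hi⟩ := G.hX.2 (x a)
  apply tm_zero G x a b b e i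
  rw [hi]
  simp only [Rect.mult, Rc, swap_l, swap_r, swap_out x hae.symm hbe.symm, inIco_iff]
  simp
  omega

theorem T4_zero (hab : a ≠ b) (hae : a ≠ e) (hbe : b ≠ e)
    (hR : ¬ inIoo (x a) (x e) (x b)) : tm G x a b e b = 0 := by
  have h1 := val_ne hab
  have h2 := val_ne hae
  have h6 := val_ne hbe
  have h3 := val_ne (x.injective.ne hab)
  have h4 := val_ne (x.injective.ne hae)
  have h5 := val_ne (x.injective.ne hbe)
  rw [inIoo_iff] at hR
  by_cases hr : inIco e b a
  · apply tm_zero G x a b e b a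
    rw [inIco_iff] at hr
    simp only [Rect.mult, Rc, swap_l, swap_r, swap_out x hae.symm hbe.symm, inIco_iff]
    simp
    omega
  · apply tm_zero G x a b e b e
    rw [inIco_iff] at hr
    simp only [Rect.mult, Rc, swap_l, swap_r, swap_out x hae.symm hbe.symm, inIco_iff]
    simp
    omega

theorem sum_three (hab : a ≠ b) (hae : a ≠ e) (hbe : b ≠ e) (f : ZMod n → ℕ) :
    ∑ k ∈ ({a, b, e} : Finset (ZMod n)), f k = f a + f b + f e := by
  rw [Finset.sum_insert (by simp [hab, hae]), Finset.sum_insert (by simp [hbe]),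
    Finset.sum_singleton, add_assoc]


theorem cyc_all {m : ℕ} [NeZero m] {a b e : ZMod m} (h : inIoo a e b) :
    inIoo b a e ∧ inIoo e b a ∧ ¬ inIoo a b e ∧ ¬ inIoo b e a ∧ ¬ inIoo e a b := by
  simp only [inIoo_iff] at *
  omega

theorem pair1 (hab : a ≠ b) (hae : a ≠ e) (hbe : b ≠ e)
    (hC : inIoo a e b) (hR : inIoo (x a) (x e) (x b)) :
    tm G x a b a e = tm G x b e a b := by
  have s1 := inIco_split hC
  have s2 := inIco_split hR
  obtain ⟨c1, c2, c3, c4, c5⟩ := cyc_all hC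
  obtain ⟨d1, d2, d3, d4, d5⟩ := cyc_all hR
  apply tm_eq G x {a, b, e} a b a e b e a b (by simp) hab hae hbe hab
  · ext k
    simp only [Equiv.Perm.mul_apply, Equiv.swap_apply_def]
    grind
  · rintro ⟨s, t⟩
    have s1 := s1 s
    have s2 := s2 t
    simp only [Rect.mult, Rc, swap_l, swap_r, swap_out x hae.symm hbe.symm,
      swap_out x hab hae]
    grind
  · rw [sum_three a b e hab hae hbe, sum_three a b e hab hae hbe]
    simp only [ii, swap_l, swap_r, swap_out x hae.symm hbe.symm,
      swap_out x hab hae, inIoo_left, inIoo_right, c1, c2, c3, c4, c5, hC,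
      d1, d2, d3, d4, d5, hR]
    try simp

theorem pair2 (hab : a ≠ b) (hae : a ≠ e) (hbe : b ≠ e)
    (hC : inIoo a b e) (hR : inIoo (x a) (x e) (x b)) :
    tm G x a b a e = tm G x a e e b := by
  have s1 := inIco_split hC
  have s2 := inIco_split hR
  obtain ⟨c1, c2, c3, c4, c5⟩ := cyc_all hC
  obtain ⟨d1, d2, d3, d4, d5⟩ := cyc_all hR
  apply tm_eq G x {a, b, e} a b a e a e e b (by simp) hab hae hae hbe.symm
  · ext k
    simp only [Equiv.Perm.mul_apply, Equiv.swap_apply_def]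
    grind
  · rintro ⟨s, t⟩
    have s1 := s1 s
    have s2 := s2 t
    simp only [Rect.mult, Rc, swap_l, swap_r, swap_out x hae.symm hbe.symm,
      swap_out x hab.symm hbe]
    grind
  · rw [sum_three a b e hab hae hbe, sum_three a b e hab hae hbe]
    simp only [ii, swap_l, swap_r, swap_out x hae.symm hbe.symm,
      swap_out x hab.symm hbe, inIoo_left, inIoo_right, c1, c2, c3, c4, c5, hC,
      d1, d2, d3, d4, d5, hR]
    try simp

theorem pair3 (hab : a ≠ b) (hae : a ≠ e) (hbe : b ≠ e)
    (hC : inIoo a e b) (hR : inIoo (x a) (x b) (x e)) :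
    tm G x a b e a = tm G x e b a b := by
  have s1 := inIco_split (cyc_rot.1 (cyc_rot.1 hC))
  have s2 := inIco_split hR
  obtain ⟨c1, c2, c3, c4, c5⟩ := cyc_all hC
  obtain ⟨d1, d2, d3, d4, d5⟩ := cyc_all hR
  apply tm_eq G x {a, b, e} a b e a e b a b (by simp) hab hae.symm hbe.symm hab
  · ext k
    simp only [Equiv.Perm.mul_apply, Equiv.swap_apply_def]
    grind
  · rintro ⟨s, t⟩
    have s1 := s1 s
    have s2 := s2 t
    simp only [Rect.mult, Rc, swap_l, swap_r, swap_out x hae.symm hbe.symm,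
      swap_out x hae hab]
    grind
  · rw [sum_three a b e hab hae hbe, sum_three a b e hab hae hbe]
    simp only [ii, swap_l, swap_r, swap_out x hae.symm hbe.symm,
      swap_out x hae hab, inIoo_left, inIoo_right, c1, c2, c3, c4, c5, hC,
      d1, d2, d3, d4, d5, hR]
    try simp

theorem pair4 (hab : a ≠ b) (hae : a ≠ e) (hbe : b ≠ e)
    (hC : inIoo a e b) (hR : inIoo (x a) (x e) (x b)) :
    tm G x a b b e = tm G x b e a e := by
  have s1 := inIco_split hC
  have s2 := inIco_split hR
  obtain ⟨c1, c2, c3, c4, c5⟩ := cyc_all hC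
  obtain ⟨d1, d2, d3, d4, d5⟩ := cyc_all hR
  apply tm_eq G x {a, b, e} a b b e b e a e (by simp) hab hbe hbe hae
  · ext k
    simp only [Equiv.Perm.mul_apply, Equiv.swap_apply_def]
    grind
  · rintro ⟨s, t⟩
    have s1 := s1 s
    have s2 := s2 t
    simp only [Rect.mult, Rc, swap_l, swap_r, swap_out x hae.symm hbe.symm,
      swap_out x hab hae]
    grind
  · rw [sum_three a b e hab hae hbe, sum_three a b e hab hae hbe]
    simp only [ii, swap_l, swap_r, swap_out x hae.symm hbe.symm,
      swap_out x hab hae, inIoo_left, inIoo_right, c1, c2, c3, c4, c5, hC,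
      d1, d2, d3, d4, d5, hR]
    try simp

end three

/-! ### Four columns -/

theorem sum_four {n : ℕ} (a b c d : ZMod n) (hab : a ≠ b) (hac : a ≠ c) (had : a ≠ d)
    (hbc : b ≠ c) (hbd : b ≠ d) (hcd : c ≠ d) (f : ZMod n → ℕ) :
    ∑ k ∈ ({a, b, c, d} : Finset (ZMod n)), f k = f a + f b + f c + f d := by
  rw [Finset.sum_insert (by simp [hab, hac, had]), Finset.sum_insert (by simp [hbc, hbd]),
    Finset.sum_insert (by simp [hcd]), Finset.sum_singleton]
  ring

/-- the linking number of two pairs of points on a circle is antisymmetric -/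
theorem link_antisymm {m : ℕ} [NeZero m] (a b c d : ZMod m) (hab : a ≠ b) (hac : a ≠ c)
    (had : a ≠ d) (hbc : b ≠ c) (hbd : b ≠ d) (hcd : c ≠ d) :
    ((inIoo c d a ↔ inIoo c d b) ∧ (inIoo a b c ↔ inIoo a b d)) ∨
    (inIoo c d a ∧ ¬ inIoo c d b ∧ ¬ inIoo a b c ∧ inIoo a b d) ∨
    (¬ inIoo c d a ∧ inIoo c d b ∧ inIoo a b c ∧ ¬ inIoo a b d) := by
  have h1 := val_ne hab
  have h2 := val_ne hac
  have h3 := val_ne had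
  have h4 := val_ne hbc
  have h5 := val_ne hbd
  have h6 := val_ne hcd
  simp only [inIoo_iff]
  omega

theorem pair_disj {n : ℕ} [NeZero n] (G : GridDiagram n) (x : GridState n) (a b c d : ZMod n)
    (hab : a ≠ b) (hac : a ≠ c)
    (had : a ≠ d) (hbc : b ≠ c) (hbd : b ≠ d) (hcd : c ≠ d) :
    tm G x a b c d = tm G x c d a b := by
  apply tm_eq G x {a, b, c, d} a b c d c d a b (by simp) hab hcd hcd hab
  · ext k
    simp only [Equiv.Perm.mul_apply, Equiv.swap_apply_def]
    grind
  · rintro ⟨s, t⟩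
    simp only [Rect.mult, Rc, swap_out x hac.symm hbc.symm, swap_out x had.symm hbd.symm,
      swap_out x hac had, swap_out x hbc hbd]
    grind
  · rw [sum_four a b c d hab hac had hbc hbd hcd, sum_four a b c d hab hac had hbc hbd hcd]
    have l1 := link_antisymm a b c d hab hac had hbc hbd hcd
    have l2 := link_antisymm (x a) (x b) (x c) (x d) (x.injective.ne hab) (x.injective.ne hac)
      (x.injective.ne had) (x.injective.ne hbc) (x.injective.ne hbd) (x.injective.ne hcd)
    simp only [ii, swap_l, swap_r, swap_out x hac.symm hbc.symm, swap_out x had.symm hbd.symm,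
      swap_out x hac had, swap_out x hbc hbd, inIoo_left, inIoo_right]
    rcases l1 with ⟨p1, p2⟩ | ⟨p1, p2, p3, p4⟩ | ⟨p1, p2, p3, p4⟩ <;>
    rcases l2 with ⟨q1, q2⟩ | ⟨q1, q2, q3, q4⟩ | ⟨q1, q2, q3, q4⟩ <;>
    simp_all


/-! ### `∂ ∘ ∂ = 0` -/

theorem GC_add_self {n : ℕ} (z : GC n) : z + z = 0 := by
  ext1 y
  rw [Finsupp.add_apply, Finsupp.zero_apply]
  exact CharTwo.add_self_eq_zero _

theorem basisMap_single {n : ℕ} (f : GridState n → GC n) (x : GridState n) (w : Rng n) :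
    basisMap f (Finsupp.single x w) = w • f x := by
  unfold basisMap
  rw [Finsupp.lsum_single, LinearMap.toSpanSingleton_apply]

theorem isRectFrom_iff {n : ℕ} (x y : GridState n) (r : Rect n) :
    IsRectFrom x y r ↔ r.cW ≠ r.cE ∧ r = Rc x r.cW r.cE ∧ y = x * Equiv.swap r.cW r.cE := by
  obtain ⟨a, b, s, t⟩ := r
  unfold IsRectFrom Rc
  simp only [Rect.mk.injEq, true_and]
  constructor
  · rintro ⟨h1, h2, h3, h4, h5, h6, h7⟩
    refine ⟨h1, ⟨h3.symm, h4.symm⟩, ?_⟩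
    ext1 k
    by_cases ka : k = a
    · subst ka; rw [swap_l, h5, h4]
    by_cases kb : k = b
    · subst kb; rw [swap_r, h6, h3]
    rw [swap_out x ka kb, h7 k ka kb]
  · rintro ⟨h1, ⟨h2, h3⟩, rfl⟩
    subst h2 h3
    refine ⟨h1, x.injective.ne h1, rfl, rfl, swap_l _ _ _, swap_r _ _ _, ?_⟩
    intro k ka kb
    rw [swap_out x ka kb]

/-- the value of `∂•` on a grid state, as a sum over ordered pairs of columns -/
def dS {n : ℕ} [NeZero n] (G : GridDiagram n) (x : GridState n) : GC n :=
  ∑ a, ∑ b, if a ≠ b ∧ XDisjoint G (Rc x a b) then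
    Finsupp.single (x * Equiv.swap a b) (wtB G x (Rc x a b)) else 0

theorem dS_eq {n : ℕ} [NeZero n] (G : GridDiagram n) (x : GridState n) :
    (∑ y : GridState n,
    ∑ r ∈ Finset.univ.filter
        (fun r : Rect n => IsRectFrom x y r ∧ XDisjoint G r),
      Finsupp.single y (wtB G x r) : GC n) = dS G x := by
  unfold dS
  rw [← Finset.sum_product', ← Finset.sum_filter]
  rw [Finset.sum_sigma']
  refine Finset.sum_bij' (fun p _ => (p.2.cW, p.2.cE))
    (fun q _ => ⟨x * Equiv.swap q.1 q.2, Rc x q.1 q.2⟩) ?_ ?_ ?_ ?_ ?_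
  · rintro ⟨y, r⟩ h
    simp only [Finset.mem_sigma, Finset.mem_univ, Finset.mem_filter, true_and] at h
    obtain ⟨h, hX⟩ := h
    rw [isRectFrom_iff] at h
    obtain ⟨h1, h2, h3⟩ := h
    simp only [Finset.mem_filter, Finset.mem_product, Finset.mem_univ, true_and]
    exact ⟨h1, h2 ▸ hX⟩
  · rintro ⟨a, b⟩ h
    simp only [Finset.mem_filter, Finset.mem_product, Finset.mem_univ, true_and] at h
    simp only [Finset.mem_sigma, Finset.mem_univ, Finset.mem_filter, true_and, isRectFrom_iff]
    exact ⟨⟨h.1, rfl, rfl⟩, h.2⟩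
  · rintro ⟨y, r⟩ h
    simp only [Finset.mem_sigma, Finset.mem_univ, Finset.mem_filter, true_and] at h
    obtain ⟨h, hX⟩ := h
    rw [isRectFrom_iff] at h
    obtain ⟨h1, h2, h3⟩ := h
    rw [← h2, ← h3]
  · rintro ⟨a, b⟩ h
    rfl
  · rintro ⟨y, r⟩ h
    simp only [Finset.mem_sigma, Finset.mem_univ, Finset.mem_filter, true_and] at h
    obtain ⟨h, hX⟩ := h
    rw [isRectFrom_iff] at h
    obtain ⟨h1, h2, h3⟩ := h
    simp only
    rw [← h2, ← h3]

theorem diffB_single {n : ℕ} [NeZero n] (G : GridDiagram n) (x : GridState n) (w : Rng n) :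
    diffB G (Finsupp.single x w) = w • dS G x := by
  unfold diffB
  rw [basisMap_single, dS_eq]

theorem diffB_dS {n : ℕ} [NeZero n] (G : GridDiagram n) (x : GridState n) :
    diffB G (dS G x) = ∑ a, ∑ b, ∑ c, ∑ d, tm G x a b c d := by
  conv_lhs => rw [dS]
  rw [map_sum]
  refine Finset.sum_congr rfl fun a _ => ?_
  rw [map_sum]
  refine Finset.sum_congr rfl fun b _ => ?_
  by_cases h : a ≠ b ∧ XDisjoint G (Rc x a b)
  · rw [if_pos h, diffB_single, dS, Finset.smul_sum]
    refine Finset.sum_congr rfl fun c _ => ?_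
    rw [Finset.smul_sum]
    refine Finset.sum_congr rfl fun d _ => ?_
    unfold tm
    rw [smul_ite, smul_zero, Finsupp.smul_single, smul_eq_mul]
    have hiff : (c ≠ d ∧ XDisjoint G (Rc (x * Equiv.swap a b) c d)) ↔
        (a ≠ b ∧ c ≠ d ∧ XDisjoint G (Rc x a b) ∧
          XDisjoint G (Rc (x * Equiv.swap a b) c d)) := by tauto
    by_cases h' : c ≠ d ∧ XDisjoint G (Rc (x * Equiv.swap a b) c d)
    · rw [if_pos h', if_pos (hiff.1 h')]
    · rw [if_neg h', if_neg (fun h'' => h' (hiff.2 h''))]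
  · rw [if_neg h, map_zero]
    symm
    refine Finset.sum_eq_zero fun c _ => Finset.sum_eq_zero fun d _ => ?_
    unfold tm
    rw [if_neg]
    tauto

/-- pairwise distinct -/
def dst {n : ℕ} (a b e : ZMod n) : Prop := a ≠ b ∧ a ≠ e ∧ b ≠ e

theorem tm_split {n : ℕ} [NeZero n] (G : GridDiagram n) (x : GridState n) (a b c d : ZMod n) :
    tm G x a b c d =
      (if a ≠ b ∧ a ≠ c ∧ a ≠ d ∧ b ≠ c ∧ b ≠ d ∧ c ≠ d then tm G x a b c d else 0)
      + (if c = a then (if dst a b d then tm G x a b a d else 0) else 0)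
      + (if d = a then (if dst a b c then tm G x a b c a else 0) else 0)
      + (if c = b then (if dst a b d then tm G x a b b d else 0) else 0)
      + (if d = b then (if dst a b c then tm G x a b c b else 0) else 0) := by
  unfold dst
  by_cases hab : a = b
  · subst hab; simp [tm]
  by_cases hcd : c = d
  · subst hcd
    have : tm G x a b c c = 0 := by simp [tm]
    rw [this]
    grind
  have e1 := tm_same G x a b
  have e2 := tm_opp G x a b
  by_cases h1 : c = a
  · subst h1
    by_cases h2 : d = b
    · subst h2; rw [e1]; simp [hab]
    · have : ¬ c = b := hab
      have h2' : ¬ b = d := fun h => h2 h.symm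
      have h3' : ¬ d = c := fun h => hcd h.symm
      simp [h2, h2', hab, hcd, h3']
  by_cases h2 : c = b
  · subst h2
    by_cases h3 : d = a
    · subst h3; rw [e2]; simp [hab]
    · have h3' : ¬ a = d := fun h => h3 h.symm
      have h4' : ¬ d = c := fun h => hcd h.symm
      simp [h1, h3, h3', hab, hcd, h4']
  have h1' : ¬ a = c := fun h => h1 h.symm
  have h2' : ¬ b = c := fun h => h2 h.symm
  by_cases h3 : d = a
  · subst h3
    simp [h1, h2, hab, h1', h2']
  by_cases h4 : d = b
  · subst h4
    simp [h1, h2, hab, h1', h2', h3]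
  have h3' : ¬ a = d := fun h => h3 h.symm
  have h4' : ¬ b = d := fun h => h4 h.symm
  simp [h1, h2, h3, h4, hab, hcd, h1', h2', h3', h4']

theorem sum_rot {n : ℕ} [NeZero n] (f : ZMod n → ZMod n → ZMod n → GC n) :
    ∑ a, ∑ b, ∑ e, f b e a = ∑ a, ∑ b, ∑ e, f a b e := by
  rw [Finset.sum_comm]
  exact Finset.sum_congr rfl fun a _ => Finset.sum_comm

theorem sum_flip {n : ℕ} [NeZero n] (f : ZMod n → ZMod n → ZMod n → GC n) :
    ∑ a, ∑ b, ∑ e, f a e b = ∑ a, ∑ b, ∑ e, f a b e :=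
  Finset.sum_congr rfl fun _ _ => Finset.sum_comm

theorem sum_rev {n : ℕ} [NeZero n] (f : ZMod n → ZMod n → ZMod n → GC n) :
    ∑ a, ∑ b, ∑ e, f e b a = ∑ a, ∑ b, ∑ e, f a b e := by
  rw [sum_rot (fun a b e => f b a e)]
  exact Finset.sum_comm

set_option maxHeartbeats 2000000 in
theorem three_sum {n : ℕ} [NeZero n] (G : GridDiagram n) (x : GridState n) :
    (∑ a, ∑ b, ∑ e, if dst a b e then tm G x a b a e else 0)
    + (∑ a, ∑ b, ∑ e, if dst a b e then tm G x a b e a else 0)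
    + (∑ a, ∑ b, ∑ e, if dst a b e then tm G x a b b e else 0)
    + (∑ a, ∑ b, ∑ e, if dst a b e then tm G x a b e b else 0) = 0 := by
  let C : ZMod n → ZMod n → ZMod n → Prop := fun a b e => inIoo a e b
  let P1 : ZMod n → ZMod n → ZMod n → GC n := fun a b e =>
    if dst a b e ∧ C a b e ∧ C (x a) (x b) (x e) then tm G x a b a e else 0
  let P2 : ZMod n → ZMod n → ZMod n → GC n := fun a b e =>
    if dst a b e ∧ C a e b ∧ C (x a) (x b) (x e) then tm G x a b a e else 0
  let P3 : ZMod n → ZMod n → ZMod n → GC n := fun a b e =>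
    if dst a b e ∧ C a b e ∧ C (x a) (x e) (x b) then tm G x a b e a else 0
  let P4 : ZMod n → ZMod n → ZMod n → GC n := fun a b e =>
    if dst a b e ∧ C a b e ∧ C (x a) (x b) (x e) then tm G x a b b e else 0
  have cn : ∀ {a b e : ZMod n}, dst a b e → (¬ C a b e ↔ C a e b) := by
    rintro a b e ⟨h1, h2, h3⟩
    exact cyc_not h1 h2 h3
  have dx : ∀ {a b e : ZMod n}, dst a b e → dst (x a) (x b) (x e) := by
    rintro a b e ⟨h1, h2, h3⟩
    exact ⟨x.injective.ne h1, x.injective.ne h2, x.injective.ne h3⟩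
  have cr : ∀ {a b e : ZMod n}, C a b e ↔ C b e a := fun {a b e} => cyc_rot
  have dr : ∀ {a b e : ZMod n}, dst a b e ↔ dst b e a := by
    intro a b e
    unfold dst
    grind
  have df : ∀ {a b e : ZMod n}, dst a b e ↔ dst a e b := by
    intro a b e
    unfold dst
    grind
  have E1 : ∀ a b e, (if dst a b e then tm G x a b a e else 0) = P1 a b e + P2 a b e := by
    intro a b e
    by_cases h : dst a b e
    · have c1 := cn h
      have c2 := cn (dx h)
      have z := T1_zero G x a b e h.1 h.2.1 h.2.2
      change ¬ C (x a) (x b) (x e) → _ at z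
      by_cases hR : C (x a) (x b) (x e)
      · by_cases hC : C a b e
        · have : ¬ C a e b := by tauto
          simp [P1, P2, h, hR, hC, this]
        · have : C a e b := by tauto
          simp [P1, P2, h, hR, hC, this]
      · simp [P1, P2, h, hR, z hR]
    · simp [P1, P2, h]
  have E2 : ∀ a b e, (if dst a b e then tm G x a b e a else 0) = P1 e a b + P3 a b e := by
    intro a b e
    have q1 : dst e a b ↔ dst a b e := dr
    have q2 : C e a b ↔ C a b e := cr
    have q3 : C (x e) (x a) (x b) ↔ C (x a) (x b) (x e) := cr
    by_cases h : dst a b e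
    · have c2 := cn (dx h)
      have z := T2_zero G x a b e h.1 h.2.1 h.2.2
      change ¬ C a b e → _ at z
      by_cases hC : C a b e
      · by_cases hR : C (x a) (x b) (x e)
        · have : ¬ C (x a) (x e) (x b) := by tauto
          simp only [P1, P3, q1, q2, q3, h, hR, hC, this]
          have := q1.2 h
          have hp := pair1 G x e a b this.1 this.2.1 this.2.2 (q2.2 hC) (q3.2 hR)
          simp [hp]
        · have : C (x a) (x e) (x b) := by tauto
          simp [P1, P3, q1, q2, q3, h, hR, hC, this]
      · simp [P1, P3, q1, q2, q3, h, hC, z hC]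
    · simp [P1, P3, q1, h]
  have E3 : ∀ a b e, (if dst a b e then tm G x a b b e else 0) = P2 a e b + P4 a b e := by
    intro a b e
    have q1 : dst a e b ↔ dst a b e := df
    by_cases h : dst a b e
    · have c2 := cn (dx h)
      have z := T3_zero G x a b e h.1 h.2.1 h.2.2
      change ¬ C a b e → _ at z
      by_cases hC : C a b e
      · by_cases hR : C (x a) (x b) (x e)
        · have : ¬ C (x a) (x e) (x b) := by tauto
          simp [P2, P4, q1, h, hR, hC, this]
        · have hR' : C (x a) (x e) (x b) := by tauto
          have := q1.2 h
          have hp := pair2 G x a e b this.1 this.2.1 this.2.2 hC hR'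
          simp [P2, P4, q1, h, hR, hC, hR', hp]
      · simp [P2, P4, q1, h, hC, z hC]
    · simp [P2, P4, q1, h]
  have E4 : ∀ a b e, (if dst a b e then tm G x a b e b else 0) = P3 e b a + P4 e a b := by
    intro a b e
    have q1 : dst e a b ↔ dst a b e := dr
    have q2 : C e a b ↔ C a b e := cr
    have q3 : C (x e) (x a) (x b) ↔ C (x a) (x b) (x e) := cr
    have r1 : dst e b a ↔ dst a b e := df.trans dr
    have r2 : C e b a ↔ C a e b := cr.trans cr
    have r3 : C (x e) (x a) (x b) ↔ C (x a) (x b) (x e) := cr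
    by_cases h : dst a b e
    · have c1 := cn h
      have z := T4_zero G x a b e h.1 h.2.1 h.2.2
      change ¬ C (x a) (x b) (x e) → _ at z
      by_cases hR : C (x a) (x b) (x e)
      · by_cases hC : C a b e
        · have hC' : ¬ C a e b := by tauto
          have := q1.2 h
          have hp := pair4 G x e a b this.1 this.2.1 this.2.2 (q2.2 hC) (q3.2 hR)
          simp [P3, P4, q1, q2, q3, r1, r2, h, hR, hC, hC', hp]
        · have hC' : C a e b := by tauto
          have := r1.2 h
          have hp := pair3 G x e b a this.1 this.2.1 this.2.2 (r2.2 hC') (r3.2 hR)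
          simp [P3, P4, q1, q2, q3, r1, r2, h, hR, hC, hC', hp]
      · simp [P3, P4, q1, q3, h, hR, z hR]
    · simp [P3, P4, q1, r1, h]
  simp only [E1, E2, E3, E4, Finset.sum_add_distrib]
  rw [← sum_rot (fun a b e => P1 e a b), sum_flip P2, sum_rev P3,
    ← sum_rot (fun a b e => P4 e a b)]
  generalize (∑ a, ∑ b, ∑ e, P1 a b e) = p1
  generalize (∑ a, ∑ b, ∑ e, P2 a b e) = p2
  generalize (∑ a, ∑ b, ∑ e, P3 a b e) = p3
  generalize (∑ a, ∑ b, ∑ e, P4 a b e) = p4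
  calc p1 + p2 + (p1 + p3) + (p2 + p4) + (p3 + p4)
      = (p1 + p1) + (p2 + p2) + (p3 + p3) + (p4 + p4) := by abel
    _ = 0 := by simp only [GC_add_self, add_zero]

theorem disj_sum {n : ℕ} [NeZero n] (G : GridDiagram n) (x : GridState n) :
    (∑ a, ∑ b, ∑ c, ∑ d,
      if a ≠ b ∧ a ≠ c ∧ a ≠ d ∧ b ≠ c ∧ b ≠ d ∧ c ≠ d then tm G x a b c d else 0) = 0 := by
  let f : (ZMod n × ZMod n) × (ZMod n × ZMod n) → GC n := fun p =>
    if p.1.1 ≠ p.1.2 ∧ p.1.1 ≠ p.2.1 ∧ p.1.1 ≠ p.2.2 ∧ p.1.2 ≠ p.2.1 ∧ p.1.2 ≠ p.2.2 ∧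
      p.2.1 ≠ p.2.2 then tm G x p.1.1 p.1.2 p.2.1 p.2.2 else 0
  have h : ∑ p, f p = 0 := by
    refine Finset.sum_involution (fun p _ => p.swap) ?_ ?_ ?_ ?_
    · rintro ⟨⟨a, b⟩, ⟨c, d⟩⟩ _
      by_cases h : a ≠ b ∧ a ≠ c ∧ a ≠ d ∧ b ≠ c ∧ b ≠ d ∧ c ≠ d
      · have h' : c ≠ d ∧ c ≠ a ∧ c ≠ b ∧ d ≠ a ∧ d ≠ b ∧ a ≠ b := by grind
        simp only [f, Prod.swap]
        rw [if_pos h, if_pos h']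
        obtain ⟨h1, h2, h3, h4, h5, h6⟩ := h
        rw [pair_disj G x a b c d h1 h2 h3 h4 h5 h6, GC_add_self]
      · have h' : ¬ (c ≠ d ∧ c ≠ a ∧ c ≠ b ∧ d ≠ a ∧ d ≠ b ∧ a ≠ b) := by grind
        simp only [f, Prod.swap]
        rw [if_neg h, if_neg h', add_zero]
    · rintro ⟨⟨a, b⟩, ⟨c, d⟩⟩ _ hne heq
      simp only [Prod.swap, Prod.mk.injEq] at heq
      apply hne
      simp only [f]
      rw [if_neg]
      intro h
      exact h.2.1 heq.2.1
    · intro _ _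
      exact Finset.mem_univ _
    · intro p _
      exact Prod.swap_swap p
  refine Eq.trans ?_ h
  simp only [Fintype.sum_prod_type, f]

theorem diffB_sq {n : ℕ} [NeZero n] (G : GridDiagram n) : diffB G ∘ₗ diffB G = 0 := by
  refine Finsupp.lhom_ext fun x w => ?_
  rw [LinearMap.comp_apply, diffB_single, map_smul, diffB_dS, LinearMap.zero_apply]
  have : (∑ a, ∑ b, ∑ c, ∑ d, tm G x a b c d) = 0 := by
    have e : ∀ a b, (∑ c, ∑ d, tm G x a b c d) =
      (∑ c, ∑ d, if a ≠ b ∧ a ≠ c ∧ a ≠ d ∧ b ≠ c ∧ b ≠ d ∧ c ≠ d then tm G x a b c d else 0)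
      + (∑ e, if dst a b e then tm G x a b a e else 0)
      + (∑ e, if dst a b e then tm G x a b e a else 0)
      + (∑ e, if dst a b e then tm G x a b b e else 0)
      + (∑ e, if dst a b e then tm G x a b e b else 0) := by
      intro a b
      rw [Finset.sum_congr rfl fun c _ => Finset.sum_congr rfl fun d _ => tm_split G x a b c d]
      simp only [Finset.sum_add_distrib]
      congr 1
      · congr 1
        · congr 1
          · congr 1
            rw [Finset.sum_comm]
            simp
          · simp
        · rw [Finset.sum_comm]
          simp
      · simp
    simp only [e, Finset.sum_add_distrib]
    rw [disj_sum, zero_add]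
    exact three_sum G x
  rw [this, smul_zero]


/-! ### The covering projection -/

/-- the lift of a coordinate to the first fundamental domain -/
def Lf {n : ℕ} (k : ZMod n) : ZMod (2 * n) := ((k.val : ℕ) : ZMod (2 * n))

theorem pr_eq {n : ℕ} [NeZero n] (a : ZMod (2 * n)) : pr a = ((a.val : ℕ) : ZMod n) := by
  unfold pr
  rw [ZMod.castHom_apply, ZMod.cast_eq_val]

theorem pr_val {n : ℕ} [NeZero n] (a : ZMod (2 * n)) :
    (a.val < n ∧ (pr a).val = a.val) ∨ (n ≤ a.val ∧ (pr a).val + n = a.val) := by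
  rw [pr_eq, ZMod.val_natCast]
  have h := ZMod.val_lt a
  by_cases h1 : a.val < n
  · left
    exact ⟨h1, Nat.mod_eq_of_lt h1⟩
  · right
    push Not at h1
    refine ⟨h1, ?_⟩
    rw [Nat.mod_eq_sub_mod h1, Nat.mod_eq_of_lt (by omega)]
    omega

theorem pr_sub {n : ℕ} (a b : ZMod (2 * n)) : pr (a - b) = pr a - pr b := map_sub _ _ _

theorem pr_add {n : ℕ} (a b : ZMod (2 * n)) : pr (a + b) = pr a + pr b := map_add _ _ _

theorem pr_one {n : ℕ} : pr (1 : ZMod (2 * n)) = 1 := map_one _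

theorem pr_natCast {n : ℕ} (k : ℕ) : pr ((k : ℕ) : ZMod (2 * n)) = (k : ZMod n) :=
  map_natCast _ _

theorem Lf_val {n : ℕ} [NeZero n] (k : ZMod n) : (Lf k).val = k.val := by
  unfold Lf
  rw [ZMod.val_natCast, Nat.mod_eq_of_lt]
  have := ZMod.val_lt k
  omega

theorem Lfn_val {n : ℕ} [NeZero n] (k : ZMod n) :
    (Lf k + (n : ZMod (2 * n))).val = k.val + n := by
  unfold Lf
  rw [← Nat.cast_add, ZMod.val_natCast, Nat.mod_eq_of_lt]
  have := ZMod.val_lt k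
  omega

theorem pr_Lf {n : ℕ} [NeZero n] (k : ZMod n) : pr (Lf k) = k := by
  unfold Lf
  rw [pr_natCast, ZMod.natCast_zmod_val]

theorem pr_Lfn {n : ℕ} [NeZero n] (k : ZMod n) : pr (Lf k + (n : ZMod (2 * n))) = k := by
  rw [pr_add, pr_Lf, pr_natCast, ZMod.natCast_self, add_zero]

theorem pr_eq_iff_Lf {n : ℕ} [NeZero n] (p : ZMod (2 * n)) (k : ZMod n) :
    pr p = k ↔ p = Lf k ∨ p = Lf k + (n : ZMod (2 * n)) := by
  rw [← (ZMod.val_injective _).eq_iff, ← (ZMod.val_injective _).eq_iff,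
    ← (ZMod.val_injective (2 * n)).eq_iff, Lf_val, Lfn_val]
  have := pr_val p
  have := ZMod.val_lt k
  omega

theorem Lf_ne {n : ℕ} [NeZero n] (k : ZMod n) : Lf k ≠ Lf k + (n : ZMod (2 * n)) := by
  rw [Ne, ← (ZMod.val_injective (2 * n)).eq_iff, Lf_val, Lfn_val]
  have := NeZero.ne n
  omega

theorem nn_zero {n : ℕ} : (n : ZMod (2 * n)) + (n : ZMod (2 * n)) = 0 := by
  rw [← Nat.cast_add, ← two_mul, ZMod.natCast_self]

theorem add_n_ne {n : ℕ} [NeZero n] (u : ZMod (2 * n)) : u ≠ u + (n : ZMod (2 * n)) := by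
  intro h
  have h0 : (n : ZMod (2 * n)) = 0 := by
    have := congrArg (fun z => z - u) h
    simpa using this.symm
  apply Lf_ne (0 : ZMod n)
  rw [h0, add_zero]

theorem pr_eq_pr {n : ℕ} [NeZero n] (u v : ZMod (2 * n)) :
    pr u = pr v ↔ u = v ∨ u = v + (n : ZMod (2 * n)) := by
  rw [pr_eq_iff_Lf]
  rcases (pr_eq_iff_Lf v (pr v)).1 rfl with h | h
  · rw [← h]
  · have h2 : v + (n : ZMod (2 * n)) = Lf (pr v) := by
      conv_lhs => rw [h]
      rw [add_assoc, nn_zero, add_zero]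
    rw [← h, h2]
    tauto

/-- push-forward of a function along `pr` -/
def push {n : ℕ} [NeZero n] {R : Type*} [CommSemiring R] (c : ZMod (2 * n) → R) (k : ZMod n) : R :=
  ∑ p, if pr p = k then c p else 0

theorem push_eq {n : ℕ} [NeZero n] {R : Type*} [CommSemiring R] (c : ZMod (2 * n) → R)
    (k : ZMod n) : push c k = c (Lf k) + c (Lf k + (n : ZMod (2 * n))) := by
  unfold push
  rw [← Finset.sum_filter]
  have : Finset.univ.filter (fun p : ZMod (2 * n) => pr p = k) =
      {Lf k, Lf k + (n : ZMod (2 * n))} := by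
    ext p
    simp [pr_eq_iff_Lf]
  rw [this, Finset.sum_pair (Lf_ne k)]

theorem push_sum {n : ℕ} [NeZero n] {R : Type*} [CommSemiring R] (c : ZMod (2 * n) → R)
    (F : ZMod n → R) : ∑ p, F (pr p) * c p = ∑ k, F k * push c k := by
  simp only [push, Finset.mul_sum]
  rw [Finset.sum_comm]
  refine Finset.sum_congr rfl fun p _ => ?_
  simp

theorem push_shift {n : ℕ} [NeZero n] {R : Type*} [CommSemiring R] (c : ZMod (2 * n) → R)
    (k : ZMod n) : push (fun p => c (p - 1)) k = push c (k - 1) := by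
  unfold push
  refine Fintype.sum_equiv (Equiv.subRight 1) _ _ fun p => ?_
  simp only [Equiv.subRight_apply, pr_sub, pr_one, sub_left_inj]

theorem push_sum2 {n : ℕ} [NeZero n] {R : Type*} [CommSemiring R] (c d : ZMod (2 * n) → R)
    (Q : ZMod n → ZMod n → Prop) [∀ k l, Decidable (Q k l)] :
    (∑ p : ZMod (2 * n) × ZMod (2 * n), if Q (pr p.1) (pr p.2) then c p.1 * d p.2 else 0) =
    ∑ k, ∑ l, if Q k l then push c k * push d l else 0 := by
  rw [Fintype.sum_prod_type]
  have h1 : ∀ p : ZMod (2 * n), (∑ q, if Q (pr p) (pr q) then c p * d q else 0) =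
      (fun k => ∑ l, (if Q k l then 1 else 0) * push d l) (pr p) * c p := by
    intro p
    simp only
    rw [← push_sum d (fun l => if Q (pr p) l then 1 else 0), Finset.sum_mul]
    refine Finset.sum_congr rfl fun q _ => ?_
    split_ifs
    · ring
    · ring
  simp only [h1]
  refine (push_sum c (fun k => ∑ l, (if Q k l then 1 else 0) * push d l)).trans ?_
  refine Finset.sum_congr rfl fun k _ => ?_
  rw [Finset.sum_mul]
  refine Finset.sum_congr rfl fun l _ => ?_
  split_ifs
  · ring
  · ring

/-- indicator of a cyclic interval -/
def ind {m : ℕ} (R : Type*) [CommSemiring R] (u v k : ZMod m) : R := if inIco u v k then 1 else 0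

theorem mult_eq_ind {m : ℕ} (R : Type*) [CommSemiring R] (r : Rect m) (p : ZMod m × ZMod m) :
    (r.mult p : R) = ind R r.cW r.cE p.1 * ind R r.rS r.rN p.2 := by
  unfold Rect.mult ind
  by_cases h1 : inIco r.cW r.cE p.1 <;> by_cases h2 : inIco r.rS r.rN p.2 <;> simp [h1, h2]

theorem push_ind {n : ℕ} [NeZero n] (R : Type*) [CommSemiring R] (u v : ZMod (2 * n))
    (h : (v - u).val < n) : push (ind R u v) = ind R (pr u) (pr v) := by
  funext k
  rw [push_eq]
  unfold ind
  have h1 := inIco_iff u v (Lf k)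
  have h2 := inIco_iff u v (Lf k + (n : ZMod (2 * n)))
  have h3 := inIco_iff (pr u) (pr v) k
  rw [Lf_val] at h1
  rw [Lfn_val] at h2
  have h4 := val_sub_eq v u
  have h5 := pr_val u
  have h6 := pr_val v
  have h7 := ZMod.val_lt k
  have h8 := ZMod.val_lt u
  have h9 := ZMod.val_lt v
  have h10 : ¬ (inIco u v (Lf k) ∧ inIco u v (Lf k + (n : ZMod (2 * n)))) := by
    rw [h1, h2]; omega
  have h11 : inIco (pr u) (pr v) k ↔
      (inIco u v (Lf k) ∨ inIco u v (Lf k + (n : ZMod (2 * n)))) := by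
    rw [h1, h2, h3]; omega
  clear h1 h2 h3
  by_cases q1 : inIco u v (Lf k) <;> by_cases q2 : inIco u v (Lf k + (n : ZMod (2 * n))) <;>
    simp_all

/-- projection of a rectangle -/
def prR {n : ℕ} (r : Rect (2 * n)) : Rect n := ⟨pr r.cW, pr r.cE, pr r.rS, pr r.rN⟩

/-- `r` is narrower and lower than `n` -/
def small {n : ℕ} (r : Rect (2 * n)) : Prop :=
  (r.cE - r.cW).val < n ∧ (r.rN - r.rS).val < n

theorem count_eq {n : ℕ} [NeZero n] (r : Rect (2 * n)) (hs : small r) (i j : ZMod n) :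
    (∑ p : ZMod (2 * n) × ZMod (2 * n), if pr p.1 = i ∧ pr p.2 = j then r.mult p else 0) =
    (prR r).mult (i, j) := by
  have h := push_sum2 (R := ℕ) (ind ℕ r.cW r.cE) (ind ℕ r.rS r.rN) (fun k l => k = i ∧ l = j)
  have e1 := fun p => mult_eq_ind ℕ r p
  have e2 := mult_eq_ind ℕ (prR r) (i, j)
  simp only [Nat.cast_id] at e1 e2
  simp only [e1, e2]
  refine h.trans ?_
  rw [push_ind ℕ _ _ hs.1, push_ind ℕ _ _ hs.2]
  rw [Finset.sum_eq_single i, Finset.sum_eq_single j]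
  · simp [prR]
  · intro b _ hb
    simp [hb]
  · simp
  · intro b _ hb
    simp [hb]
  · simp

theorem XDisjoint4_iff {n : ℕ} [NeZero n] (G : GridDiagram n) (r : Rect (2 * n)) (hs : small r) :
    XDisjoint4 G r ↔ XDisjoint G (prR r) := by
  unfold XDisjoint4 XDisjoint X4count Xcount
  simp only [count_eq r hs]

theorem O4count_eq {n : ℕ} [NeZero n] (G : GridDiagram n) (r : Rect (2 * n)) (hs : small r)
    (i : ZMod n) : O4count G r i = Ocount G (prR r) i := count_eq r hs _ _

theorem rpm4_eq {n : ℕ} [NeZero n] (w : GridState n) (r : Rect (2 * n)) (hs : small r) :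
    rpm4 w r = Rect.pm w (prR r) := by
  unfold rpm4 pm4 Rect.pm Rect.dom4
  congr 1
  set C := ind ℚ r.cW r.cE with hC
  set D := ind ℚ r.rS r.rN with hD
  have h11 : (∑ p : ZMod (2 * n) × ZMod (2 * n),
      if w (pr p.1) = pr p.2 then C (p.1 - 1) * D (p.2 - 1) else 0) =
      ∑ k, ∑ l, if w k = l then push (fun u => C (u - 1)) k * push (fun u => D (u - 1)) l else 0 :=
    push_sum2 (fun u => C (u - 1)) (fun u => D (u - 1)) (fun k l => w k = l)
  have h01 : (∑ p : ZMod (2 * n) × ZMod (2 * n),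
      if w (pr p.1) = pr p.2 then C p.1 * D (p.2 - 1) else 0) =
      ∑ k, ∑ l, if w k = l then push (C) k * push (fun u => D (u - 1)) l else 0 :=
    push_sum2 (C) (fun u => D (u - 1)) (fun k l => w k = l)
  have h10 : (∑ p : ZMod (2 * n) × ZMod (2 * n),
      if w (pr p.1) = pr p.2 then C (p.1 - 1) * D p.2 else 0) =
      ∑ k, ∑ l, if w k = l then push (fun u => C (u - 1)) k * push (D) l else 0 :=
    push_sum2 (fun u => C (u - 1)) (D) (fun k l => w k = l)
  have h00 : (∑ p : ZMod (2 * n) × ZMod (2 * n),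
      if w (pr p.1) = pr p.2 then C p.1 * D p.2 else 0) =
      ∑ k, ∑ l, if w k = l then push (C) k * push (D) l else 0 :=
    push_sum2 (C) (D) (fun k l => w k = l)
  have e : ∀ p : ZMod (2 * n) × ZMod (2 * n),
      (if w (pr p.1) = pr p.2 then
        (((r.mult (p.1 - 1, p.2 - 1) : ℤ) + (r.mult (p.1, p.2 - 1) : ℤ) +
          (r.mult (p.1 - 1, p.2) : ℤ) + (r.mult p : ℤ) : ℤ) : ℚ) else 0) =
      (if w (pr p.1) = pr p.2 then C (p.1 - 1) * D (p.2 - 1) else 0) +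
      (if w (pr p.1) = pr p.2 then C p.1 * D (p.2 - 1) else 0) +
      (if w (pr p.1) = pr p.2 then C (p.1 - 1) * D p.2 else 0) +
      (if w (pr p.1) = pr p.2 then C p.1 * D p.2 else 0) := by
    intro p
    by_cases hp : w (pr p.1) = pr p.2
    · simp only [if_pos hp]
      push_cast
      simp only [mult_eq_ind ℚ, hC, hD]
    · simp only [if_neg hp, add_zero]
  rw [Finset.sum_congr rfl fun p _ => e p]
  simp only [Finset.sum_add_distrib, h11, h01, h10, h00]
  simp only [push_shift, Finset.sum_ite_eq, Finset.mem_univ, if_true]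
  simp only [push_shift, hC, hD, push_ind ℚ _ _ hs.1, push_ind ℚ _ _ hs.2]
  rw [← Finset.sum_add_distrib, ← Finset.sum_add_distrib, ← Finset.sum_add_distrib]
  refine Finset.sum_congr rfl fun k _ => ?_
  push_cast
  simp only [mult_eq_ind ℚ, prR]

theorem val_pred {m : ℕ} [NeZero m] {a b : ZMod m} (hab : a ≠ b) (k : ZMod m) :
    (1 ≤ k.val ∧ (k - 1).val + 1 = k.val) ∨ (k.val = 0 ∧ (k - 1).val + 1 = m) := by
  have h1 := val_ne hab
  have h2 := ZMod.val_lt a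
  have h3 := ZMod.val_lt b
  have : Fact (1 < m) := ⟨by omega⟩
  have h4 := val_sub_eq k 1
  rw [ZMod.val_one] at h4
  omega

theorem ind_pred {m : ℕ} [NeZero m] {a b : ZMod m} (hab : a ≠ b) :
    ind ℚ a b a = 1 ∧ ind ℚ a b b = 0 ∧ ind ℚ a b (a - 1) = 0 ∧ ind ℚ a b (b - 1) = 1 ∧
    ∀ k, k ≠ a → k ≠ b → ind ℚ a b (k - 1) = ind ℚ a b k := by
  have h1 := val_ne hab
  have h2 := ZMod.val_lt a
  have h3 := ZMod.val_lt b
  have h4 := val_pred hab a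
  have h5 := val_pred hab b
  unfold ind
  simp only [inIco_iff]
  refine ⟨?_, ?_, ?_, ?_, ?_⟩
  · rw [if_pos]; omega
  · rw [if_neg]; omega
  · rw [if_neg]; omega
  · rw [if_pos]; omega
  · intro k ka kb
    have h6 := val_pred hab k
    have h7 := val_ne ka
    have h8 := val_ne kb
    have h9 := ZMod.val_lt k
    refine if_congr ?_ rfl rfl
    omega

theorem pm_eq {n : ℕ} [NeZero n] (x w : GridState n) (a b : ZMod n) (hab : a ≠ b)
    (hw : w = x ∨ w = x * Equiv.swap a b) :
    Rect.pm w (Rc x a b) = (Rect.intCount x (Rc x a b) : ℚ) + 1 / 2 := by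
  have hx := x.injective.ne hab
  obtain ⟨a1, a2, a3, a4, a5⟩ := ind_pred hab
  obtain ⟨b1, b2, b3, b4, b5⟩ := ind_pred hx
  rw [intCount_eq]
  unfold Rect.pm
  push_cast
  simp only [mult_eq_ind ℚ]
  rw [← Finset.sum_add_sum_compl {a, b}, ← Finset.sum_add_sum_compl {a, b} (fun k => (ii x a b k : ℚ)),
    Finset.sum_pair hab, Finset.sum_pair hab]
  have hc : ∀ k ∈ ({a, b} : Finset (ZMod n))ᶜ,
      ind ℚ (Rc x a b).cW (Rc x a b).cE (k - 1) * ind ℚ (Rc x a b).rS (Rc x a b).rN (w k - 1) +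
      ind ℚ (Rc x a b).cW (Rc x a b).cE k * ind ℚ (Rc x a b).rS (Rc x a b).rN (w k - 1) +
      ind ℚ (Rc x a b).cW (Rc x a b).cE (k - 1) * ind ℚ (Rc x a b).rS (Rc x a b).rN (w k) +
      ind ℚ (Rc x a b).cW (Rc x a b).cE k * ind ℚ (Rc x a b).rS (Rc x a b).rN (w k) =
      4 * (ii x a b k : ℚ) := by
    intro k hk
    simp only [Finset.mem_compl, Finset.mem_insert, Finset.mem_singleton, not_or] at hk
    have hwk : w k = x k := by
      rcases hw with rfl | rfl
      · rfl
      · exact swap_out x hk.1 hk.2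
    rw [ii_eq_mult _ _ _ _ hk.1, mult_eq_ind ℚ, hwk]
    simp only [Rc]
    rw [a5 k hk.1 hk.2, b5 (x k) (x.injective.ne hk.1) (x.injective.ne hk.2)]
    ring
  rw [Finset.sum_congr rfl hc, ← Finset.mul_sum]
  have i1 : ii x a b a = 0 := by simp [ii, inIoo_left]
  have i2 : ii x a b b = 0 := by simp [ii, inIoo_right]
  rw [i1, i2]
  rcases hw with rfl | rfl
  · simp only [Rc, a1, a2, a3, a4, b1, b2, b3, b4]
    push_cast
    ring
  · simp only [Rc, swap_l, swap_r, a1, a2, a3, a4, b1, b2, b3, b4]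
    push_cast
    ring

theorem m4_eq {n : ℕ} [NeZero n] (x y : GridState n) (r : Rect (2 * n)) (hs : small r)
    (hr : IsRectFrom x y (prR r)) : m4 x y r = Rect.intCount x (prR r) := by
  rw [isRectFrom_iff] at hr
  obtain ⟨h1, h2, h3⟩ := hr
  unfold m4 mQ4
  rw [rpm4_eq _ _ hs, rpm4_eq _ _ hs, h2, pm_eq x x _ _ h1 (Or.inl rfl), pm_eq x y _ _ h1 (Or.inr h3)]
  have : ∀ q : ℕ, ((q : ℚ) + 1 / 2 + ((q : ℚ) + 1 / 2) - 1) / 2 = (q : ℚ) := by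
    intro q; ring
  rw [this, Int.floor_natCast, Int.toNat_natCast]

theorem wt4_eq {n : ℕ} [NeZero n] (G : GridDiagram n) (x y : GridState n) (r : Rect (2 * n))
    (hs : small r) (hr : IsRectFrom x y (prR r)) : wt4 G x y r = wtB G x (prR r) := by
  unfold wt4 wtB
  rw [m4_eq x y r hs hr]
  simp only [O4count_eq G r hs]

/-! ### Boundary conditions -/

theorem fib4 {n : ℕ} [NeZero n] (p : ZMod (2 * n) × ZMod (2 * n)) (e s : ZMod (2 * n)) :
    (if p = (e, s) then (1 : ℤ) else 0) + (if p = (e, s + (n : ZMod (2 * n))) then 1 else 0)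
    + (if p = (e + (n : ZMod (2 * n)), s) then 1 else 0)
    + (if p = (e + (n : ZMod (2 * n)), s + (n : ZMod (2 * n))) then 1 else 0) =
    if (pr p.1, pr p.2) = (pr e, pr s) then 1 else 0 := by
  obtain ⟨u, v⟩ := p
  simp only [Prod.mk.injEq, pr_eq_pr]
  have h1 := add_n_ne e
  have h2 := add_n_ne s
  grind

theorem cornerA_sum {n : ℕ} [NeZero n] (r : Rect (2 * n)) (p : ZMod (2 * n) × ZMod (2 * n)) :
    cornerA r p + cornerA (trN r) p + cornerA (trE r) p + cornerA (trN (trE r)) p =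
    cornerA (prR r) (pr p.1, pr p.2) := by
  unfold cornerA trN trE prR
  simp only
  rw [← fib4, ← fib4, ← fib4, ← fib4]
  ring

theorem cornerB_eq {m : ℕ} (r : Rect m) (p : ZMod m × ZMod m) : cornerB r p = - cornerA r p := by
  unfold cornerA cornerB
  ring

theorem isRect4From_iff {n : ℕ} [NeZero n] (x y : GridState n) (r : Rect (2 * n)) :
    IsRect4From x y r ↔ r.cW ≠ r.cE ∧ r.rS ≠ r.rN ∧
      ∀ k l : ZMod n, cornerA (prR r) (k, l) =
        (if y k = l then 1 else 0) - (if x k = l then 1 else 0) := by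
  unfold IsRect4From
  simp only [cornerB_eq]
  have e : (∀ k l : ZMod n, cornerA (prR r) (k, l) =
        (if y k = l then 1 else 0) - (if x k = l then 1 else 0)) ↔
      (∀ p, cornerA r p + cornerA (trN r) p + cornerA (trE r) p + cornerA (trN (trE r)) p
      = stInd y p - stInd x p) := by
    simp only [cornerA_sum, stInd]
    constructor
    · intro h p
      exact h _ _
    · intro h k l
      have := h (Lf k, Lf l)
      simpa only [pr_Lf] using this
  rw [e]
  constructor
  · rintro ⟨h1, h2, h3, -⟩
    exact ⟨h1, h2, h3⟩
  · rintro ⟨h1, h2, h3⟩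
    refine ⟨h1, h2, h3, fun p => ?_⟩
    have := h3 p
    linarith

theorem corner_iff {n : ℕ} (x y : GridState n) (a b s t : ZMod n) (hab : a ≠ b) (hst : s ≠ t) :
    (∀ k l : ZMod n, cornerA ⟨a, b, s, t⟩ (k, l) =
        (if y k = l then 1 else 0) - (if x k = l then 1 else 0)) ↔
    IsRectFrom x y ⟨a, b, s, t⟩ := by
  unfold cornerA IsRectFrom
  simp only [Prod.mk.injEq]
  constructor
  · intro h
    have h1 := h a s
    have h2 := h b t
    have h3 := h a t
    have h4 := h b s
    refine ⟨hab, hst, ?_, ?_, ?_, ?_, ?_⟩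
    · grind
    · grind
    · grind
    · grind
    · intro k ka kb
      have h5 := h k (x k)
      simp only [ka, kb] at h5
      by_contra h'
      have h'' : ¬ y k = x k := fun q => h' q.symm
      rw [if_neg h''] at h5
      simp at h5
  · rintro ⟨-, -, h1, h2, h3, h4, h5⟩ k l
    by_cases ka : k = a
    · subst ka
      rw [h1, h3]
      simp only [hab]
      simp [eq_comm]
    by_cases kb : k = b
    · subst kb
      rw [h2, h4]
      simp only [hab.symm]
      simp [eq_comm]
    rw [h5 k ka kb]
    simp [ka, kb]

theorem pr_val_small {n : ℕ} [NeZero n] {a : ZMod (2 * n)} (h : a.val < n) :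
    (pr a).val = a.val := by
  have := pr_val a
  omega

theorem pr_ne {n : ℕ} [NeZero n] {u v : ZMod (2 * n)} (h : (v - u).val < n) (hne : u ≠ v) :
    pr u ≠ pr v := by
  intro h'
  have h1 := pr_val_small h
  rw [pr_sub, h', sub_self, ZMod.val_zero] at h1
  have := (ZMod.val_eq_zero _).1 h1.symm
  exact hne (sub_eq_zero.1 this).symm

theorem rect4_iff {n : ℕ} [NeZero n] (x y : GridState n) (r : Rect (2 * n)) (hs : small r) :
    IsRect4From x y r ↔ IsRectFrom x y (prR r) := by
  rw [isRect4From_iff]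
  constructor
  · rintro ⟨h1, h2, h3⟩
    exact (corner_iff x y _ _ _ _ (pr_ne hs.1 h1) (pr_ne hs.2 h2)).1 h3
  · intro h
    have h1 : pr r.cW ≠ pr r.cE := h.1
    have h2 : pr r.rS ≠ pr r.rN := h.2.1
    exact ⟨fun q => h1 (congrArg _ q), fun q => h2 (congrArg _ q),
      (corner_iff x y _ _ _ _ h1 h2).2 h⟩

theorem wide_cover {n : ℕ} [NeZero n] {u v : ZMod (2 * n)} (h : n ≤ (v - u).val) (k : ZMod n) :
    ∃ p, pr p = k ∧ inIco u v p := by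
  have h1 := inIco_iff u v (Lf k)
  have h2 := inIco_iff u v (Lf k + (n : ZMod (2 * n)))
  rw [Lf_val] at h1
  rw [Lfn_val] at h2
  have h4 := val_sub_eq v u
  have h7 := ZMod.val_lt k
  have h8 := ZMod.val_lt u
  have h9 := ZMod.val_lt v
  by_cases h10 : inIco u v (Lf k)
  · exact ⟨_, pr_Lf k, h10⟩
  · refine ⟨_, pr_Lfn k, ?_⟩
    rw [h1] at h10
    rw [h2]
    omega

theorem inIco_start {m : ℕ} [NeZero m] {u v : ZMod m} (h : u ≠ v) : inIco u v u := by
  have := val_ne h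
  rw [inIco_iff]
  omega

theorem X4_pos {n : ℕ} [NeZero n] (G : GridDiagram n) (r : Rect (2 * n))
    (p q : ZMod (2 * n)) (hpq : pr q = G.Xrow (pr p)) (h1 : inIco r.cW r.cE p)
    (h2 : inIco r.rS r.rN q) : ¬ XDisjoint4 G r := by
  intro h
  have h := h (pr p)
  unfold X4count at h
  rw [Finset.sum_eq_zero_iff] at h
  have h := h (p, q) (Finset.mem_univ _)
  simp [hpq, Rect.mult, h1, h2] at h

theorem small_of {n : ℕ} [NeZero n] (G : GridDiagram n) (x y : GridState n) (r : Rect (2 * n))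
    (h : IsRect4From x y r) (hX : XDisjoint4 G r) : small r := by
  obtain ⟨hc, hr, -, -⟩ := h
  constructor
  · by_contra hw
    push Not at hw
    obtain ⟨i, hi⟩ := G.hX.2 (pr r.rS)
    obtain ⟨p, hp, hp'⟩ := wide_cover hw i
    exact X4_pos G r p r.rS (by rw [hp, hi]) hp' (inIco_start hr) hX
  · by_contra hw
    push Not at hw
    obtain ⟨q, hq, hqb⟩ := wide_cover hw (G.Xrow (pr r.cW))
    exact X4_pos G r r.cW q hq (inIco_start hc) hqb hX

/-- the lift of the endpoint `v` of a cyclic interval starting at `u` -/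
def up {n : ℕ} (u v : ZMod n) : ZMod (2 * n) := Lf u + (((v - u).val : ℕ) : ZMod (2 * n))

theorem pr_up {n : ℕ} [NeZero n] (u v : ZMod n) : pr (up u v) = v := by
  unfold up
  rw [pr_add, pr_Lf, pr_natCast, ZMod.natCast_zmod_val]
  ring

theorem up_val {n : ℕ} [NeZero n] (u v : ZMod n) : (up u v - Lf u).val < n := by
  unfold up
  rw [add_sub_cancel_left]
  have h := ZMod.val_lt (v - u)
  rw [ZMod.val_natCast, Nat.mod_eq_of_lt (by omega)]
  exact h

theorem Lf_pr {n : ℕ} [NeZero n] {u : ZMod (2 * n)} (h : u.val < n) : Lf (pr u) = u := by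
  apply ZMod.val_injective
  rw [Lf_val, pr_val_small h]

theorem up_pr {n : ℕ} [NeZero n] {u v : ZMod (2 * n)} (h : u.val < n) (h' : (v - u).val < n) :
    up (pr u) (pr v) = v := by
  unfold up
  rw [Lf_pr h, ← pr_sub, pr_val_small h', ZMod.natCast_zmod_val]
  ring

/-- the normalized lift of a rectangle -/
def upR {n : ℕ} (r : Rect n) : Rect (2 * n) := ⟨Lf r.cW, up r.cW r.cE, Lf r.rS, up r.rS r.rN⟩

theorem prR_upR {n : ℕ} [NeZero n] (r : Rect n) : prR (upR r) = r := by
  unfold prR upR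
  simp only [pr_Lf, pr_up]

theorem diff4_eq {n : ℕ} [NeZero n] (G : GridDiagram n) : diff4 G = diffB G := by
  unfold diff4 diffB
  congr 1
  funext x
  refine Finset.sum_congr rfl fun y _ => ?_
  refine Finset.sum_bij' (fun r _ => prR r) (fun r _ => upR r) ?_ ?_ ?_ ?_ ?_
  · intro r h
    simp only [Finset.mem_filter, Finset.mem_univ, true_and] at h ⊢
    obtain ⟨h1, h2, h3⟩ := h
    have hs := small_of G x y r h1 h3
    exact ⟨(rect4_iff x y r hs).1 h1, (XDisjoint4_iff G r hs).1 h3⟩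
  · intro r h
    simp only [Finset.mem_filter, Finset.mem_univ, true_and] at h ⊢
    obtain ⟨h1, h2⟩ := h
    have hs : small (upR r) := ⟨up_val _ _, up_val _ _⟩
    refine ⟨(rect4_iff x y _ hs).2 ?_, ⟨?_, ?_⟩, (XDisjoint4_iff G _ hs).2 ?_⟩
    · rwa [prR_upR]
    · change (Lf r.cW).val < n
      rw [Lf_val]
      exact ZMod.val_lt _
    · change (Lf r.rS).val < n
      rw [Lf_val]
      exact ZMod.val_lt _
    · rwa [prR_upR]
  · intro r h
    simp only [Finset.mem_filter, Finset.mem_univ, true_and] at h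
    obtain ⟨h1, h2, h3⟩ := h
    have hs := small_of G x y r h1 h3
    unfold upR prR
    simp only [Lf_pr h2.1, Lf_pr h2.2, up_pr h2.1 hs.1, up_pr h2.2 hs.2]
  · intro r _
    exact prR_upR r
  · intro r h
    simp only [Finset.mem_filter, Finset.mem_univ, true_and] at h
    obtain ⟨h1, h2, h3⟩ := h
    have hs := small_of G x y r h1 h3
    rw [wt4_eq G x y r hs ((rect4_iff x y r hs).1 h1)]


/-- `(GC•(𝔾), ∂•)` is a chain complex, and the module isomorphism
`J₄ : GC•(𝔾) → GC•(𝔾₄)` induced by `x ↦ x₄` (in this model the grid states of `𝔾₄`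
are canonically identified with those of `𝔾`, so `J₄` is the identity linear map)
satisfies `∂₄• ∘ J₄ = J₄ ∘ ∂•`; hence `J₄` is an isomorphism of bigraded chain
complexes. -/
theorem statement5 (n : ℕ) [NeZero n] (G : GridDiagram n) :
    diffB G ∘ₗ diffB G = 0 ∧
    diff4 G ∘ₗ (LinearMap.id : GC n →ₗ[Rng n] GC n)
      = (LinearMap.id : GC n →ₗ[Rng n] GC n) ∘ₗ diffB G ∧
    Function.Bijective (LinearMap.id : GC n →ₗ[Rng n] GC n) ∧
    (∀ z d s, IsHomog G z d s ↔ IsHomog G ((LinearMap.id : GC n →ₗ[Rng n] GC n) z) d s) := by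
  refine ⟨diffB_sq G, ?_, Function.bijective_id, fun z d s => Iff.rfl⟩
  rw [LinearMap.comp_id, LinearMap.id_comp, diff4_eq]

end GridHomology
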